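/- arXiv:1009.0814 — 6 statements merged into one kernel-verified Lean document; each statement's English description precedes it below -/
import Mathlib

section
/- The following two conditions are equivalent: (i) ∫_{(1,∞)} ℓ log(ℓ) π(dℓ) < ∞; (ii) ∫_0^1 (1/(αv) − 1/ψ(v)) dv < ∞. (Note that the integrand in (ii) is nonnegative since ψ(v) ≥ αv for all v ≥ 0.) -/
open MeasureTheory Set Filter

lemma aux_up (u : ℝ) (hu : 0 ≤ u) : Real.exp (-u) - 1 + u ≤ u ^ 2 / (1 + u) := by
  have h1 : Real.exp (-u) ≤ 1 / (1 + u) := by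
    rw [Real.exp_neg, ← one_div]
    apply one_div_le_one_div_of_le (by linarith)
    linarith [Real.add_one_le_exp u]
  have h2 : u ^ 2 / (1 + u) = 1 / (1 + u) - 1 + u := by
    field_simp
    ring
  rw [h2]; linarith

lemma aux_low (u : ℝ) (hu : 0 ≤ u) : u ^ 2 / (1 + u) ≤ 4 * (Real.exp (-u) - 1 + u) := by
  rw [div_le_iff₀ (by linarith)]
  rcases le_total u 2 with h | h
  · have h1 : (1 - u / 2) ^ 2 ≤ Real.exp (-u) := by
      have h2 : 1 - u / 2 ≤ Real.exp (-(u / 2)) := by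
        linarith [Real.add_one_le_exp (-(u / 2))]
      have h3 : Real.exp (-u) = Real.exp (-(u / 2)) ^ 2 := by
        rw [← Real.exp_nat_mul]; congr 1; push_cast; ring
      rw [h3]
      exact pow_le_pow_left₀ (by linarith) h2 2
    have h4 : u ^ 2 ≤ 4 * (Real.exp (-u) - 1 + u) := by nlinarith
    nlinarith [sq_nonneg u]
  · have := Real.exp_pos (-u)
    nlinarith

lemma aux_int (l : ℝ) (hl : 0 < l) :
    ∫ v in Ioc (0:ℝ) 1, l ^ 2 / (1 + v * l) = l * Real.log (1 + l) := by
  rw [← intervalIntegral.integral_of_le zero_le_one]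
  have key : ∀ v ∈ uIcc (0:ℝ) 1, HasDerivAt (fun v => l * Real.log (1 + v * l))
      (l ^ 2 / (1 + v * l)) v := by
    intro v hv
    rw [uIcc_of_le zero_le_one] at hv
    have hp : 0 < 1 + v * l := by nlinarith [mul_nonneg hv.1 hl.le]
    have h1 : HasDerivAt (fun v : ℝ => 1 + v * l) l v := by
      simpa using ((hasDerivAt_id v).mul_const l).const_add 1
    exact ((h1.log hp.ne').const_mul l).congr_deriv (by ring)
  rw [intervalIntegral.integral_eq_sub_of_hasDerivAt key]
  · simp
  · apply ContinuousOn.intervalIntegrable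
    rw [uIcc_of_le zero_le_one]
    apply ContinuousOn.div (by fun_prop) (by fun_prop)
    intro v hv
    have : 0 < 1 + v * l := by nlinarith [mul_nonneg hv.1 hl.le]
    exact this.ne'

lemma aux_bd (v l : ℝ) (hv : 0 < v) (hv1 : v ≤ 1) (hl : 0 < l) :
    l ^ 2 / (1 + v * l) ≤ min l (l ^ 2) / v := by
  have hp : 0 < v * l := mul_pos hv hl
  rw [div_le_div_iff₀ (by linarith) hv]
  rcases min_choice l (l ^ 2) with h | h <;> rw [h]
  · nlinarith
  · have : 0 < l ^ 2 := by positivity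
    nlinarith

/-- The statement about the comparison kernel. -/
lemma aux_tonelli (μ : Measure ℝ) [SFinite μ] (hμ : ∀ᵐ l ∂μ, 0 < l)
    (hm : Integrable (fun l => min l (l ^ 2)) μ) :
    Integrable (fun l => l * Real.log (1 + l)) μ ↔
      IntegrableOn (fun v => ∫ l, l ^ 2 / (1 + v * l) ∂μ) (Ioc 0 1) := by
  have hmeas : AEStronglyMeasurable (fun p : ℝ × ℝ => p.2 ^ 2 / (1 + p.1 * p.2))
      ((volume.restrict (Ioc (0:ℝ) 1)).prod μ) := by
    apply Measurable.aestronglyMeasurable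
    fun_prop
  have h1 := integrable_prod_iff hmeas
  have h2 := integrable_prod_iff' hmeas
  have hv : ∀ᵐ v ∂(volume.restrict (Ioc (0:ℝ) 1)), v ∈ Ioc (0:ℝ) 1 :=
    ae_restrict_mem measurableSet_Ioc
  have a1 : ∀ᵐ v ∂(volume.restrict (Ioc (0:ℝ) 1)),
      Integrable (fun l => l ^ 2 / (1 + v * l)) μ := by
    filter_upwards [hv] with v hv
    apply (hm.div_const v).mono' (Measurable.aestronglyMeasurable (by fun_prop))
    filter_upwards [hμ] with l hl
    have := mul_pos hv.1 hl
    rw [Real.norm_of_nonneg (by positivity)]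
    exact aux_bd v l hv.1 hv.2 hl
  have a2 : ∀ᵐ l ∂μ, Integrable (fun v => l ^ 2 / (1 + v * l)) (volume.restrict (Ioc (0:ℝ) 1)) := by
    filter_upwards [hμ] with l hl
    apply (integrable_const (l ^ 2)).mono' (Measurable.aestronglyMeasurable (by fun_prop))
    filter_upwards [hv] with v hv
    have := mul_pos hv.1 hl
    rw [Real.norm_of_nonneg (by positivity)]
    apply div_le_self (by positivity) (by linarith)
  have e1 : (fun v => ∫ l, ‖l ^ 2 / (1 + v * l)‖ ∂μ) =ᵐ[volume.restrict (Ioc (0:ℝ) 1)]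
      (fun v => ∫ l, l ^ 2 / (1 + v * l) ∂μ) := by
    filter_upwards [hv] with v hv
    apply integral_congr_ae
    filter_upwards [hμ] with l hl
    have := mul_pos hv.1 hl
    rw [Real.norm_of_nonneg (by positivity)]
  have e2 : (fun l => ∫ v in Ioc (0:ℝ) 1, ‖l ^ 2 / (1 + v * l)‖) =ᵐ[μ]
      (fun l => l * Real.log (1 + l)) := by
    filter_upwards [hμ] with l hl
    rw [← aux_int l hl]
    apply integral_congr_ae
    filter_upwards [hv] with v hv
    have := mul_pos hv.1 hl
    rw [Real.norm_of_nonneg (by positivity)]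
  rw [h2] at h1
  simp only [a1, a2, true_and] at h1
  rw [integrable_congr e1, integrable_congr e2] at h1
  exact h1

lemma aux_sfinite (pi : Measure ℝ)
    (hpi : IntegrableOn (fun ℓ => min ℓ (ℓ ^ 2)) (Set.Ioi 0) pi) :
    SigmaFinite (pi.restrict (Ioi 0)) := by
  have hfin : ∀ n : ℕ, pi (Ioi (1 / ((n:ℝ) + 1))) < ⊤ := by
    intro n
    set e : ℝ := 1 / ((n:ℝ) + 1) with he
    have hep : 0 < e := by positivity
    have h := hpi.measure_norm_ge_lt_top (ε := min e (e ^ 2)) (by positivity)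
    refine lt_of_le_of_lt ?_ h
    rw [← Measure.restrict_apply_self, ← Measure.restrict_restrict_of_subset (Ioi_subset_Ioi hep.le)]
    refine (Measure.restrict_apply_le _ _).trans (measure_mono ?_)
    · intro x hx
      have hx : e < x := hx
      have : 0 < x := hep.trans hx
      simp only [mem_setOf_eq]
      rw [Real.norm_of_nonneg (by positivity)]
      exact min_le_min hx.le (pow_le_pow_left₀ hep.le hx.le 2)
  refine ⟨⟨⟨fun n => Iic 0 ∪ Ioi (1 / ((n:ℝ) + 1)), fun _ => trivial, fun n => ?_, ?_⟩⟩⟩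
  · refine (measure_union_le _ _).trans_lt ?_
    have h0 : (pi.restrict (Ioi 0)) (Iic (0:ℝ)) = 0 := by
      have hE : Iic (0:ℝ) ∩ Ioi 0 = ∅ := by
        ext x
        simp
      rw [Measure.restrict_apply measurableSet_Iic, hE, measure_empty]
    rw [h0, zero_add]
    exact (Measure.restrict_apply_le _ _).trans_lt (hfin n)
  · rw [eq_univ_iff_forall]
    intro x
    rw [mem_iUnion]
    rcases le_or_gt x 0 with h | h
    · exact ⟨0, Or.inl h⟩
    · obtain ⟨n, hn⟩ := exists_nat_one_div_lt h
      exact ⟨n, Or.inr hn⟩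

lemma aux_log (pi : Measure ℝ)
    (hpi : IntegrableOn (fun ℓ => min ℓ (ℓ ^ 2)) (Set.Ioi 0) pi) :
    IntegrableOn (fun ℓ => ℓ * Real.log ℓ) (Set.Ioi 1) pi ↔
      Integrable (fun l => l * Real.log (1 + l)) (pi.restrict (Ioi 0)) := by
  constructor
  · intro h
    have hu : Ioi (0:ℝ) = Ioc 0 1 ∪ Ioi 1 := (Ioc_union_Ioi_eq_Ioi zero_le_one).symm
    change IntegrableOn _ _ _
    rw [hu]
    apply IntegrableOn.union
    · apply Integrable.mono' (hpi.mono_set Ioc_subset_Ioi_self)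
        (Measurable.aestronglyMeasurable (by fun_prop))
      filter_upwards [ae_restrict_mem measurableSet_Ioc] with l hl
      have hl0 := hl.1
      have h1 : 0 ≤ Real.log (1 + l) := Real.log_nonneg (by linarith)
      have h2 : Real.log (1 + l) ≤ l := by
        linarith [Real.log_le_sub_one_of_pos (show 0 < 1 + l by linarith)]
      rw [Real.norm_of_nonneg (by positivity), min_eq_right (by nlinarith [hl.2])]
      nlinarith
    · apply Integrable.mono'
        (((hpi.mono_set (Ioi_subset_Ioi zero_le_one)).const_mul (Real.log 2)).add h)
        (Measurable.aestronglyMeasurable (by fun_prop))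
      filter_upwards [ae_restrict_mem measurableSet_Ioi] with l hl
      have hl : 1 < l := hl
      have h1 : 0 ≤ Real.log (1 + l) := Real.log_nonneg (by linarith)
      have h2 : Real.log (1 + l) ≤ Real.log 2 + Real.log l := by
        rw [← Real.log_mul (by norm_num) (by linarith)]
        exact Real.log_le_log (by linarith) (by linarith)
      rw [Real.norm_of_nonneg (by positivity)]
      simp only [Pi.add_apply]
      rw [min_eq_left (by nlinarith)]
      nlinarith
  · intro h
    have h : IntegrableOn (fun l => l * Real.log (1 + l)) (Ioi 0) pi := h
    apply Integrable.mono' (h.mono_set (Ioi_subset_Ioi zero_le_one))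
      (Measurable.aestronglyMeasurable (by fun_prop))
    filter_upwards [ae_restrict_mem measurableSet_Ioi] with l hl
    have hl : 1 < l := hl
    have h1 : 0 ≤ Real.log l := Real.log_nonneg (by linarith)
    rw [Real.norm_of_nonneg (by positivity)]
    have := Real.log_le_log (show 0 < l by linarith) (show l ≤ 1 + l by linarith)
    nlinarith

/-- The conditions `∫_{(1,∞)} ℓ log ℓ π(dℓ) < ∞` and
`∫_0^1 (1/(αv) − 1/ψ(v)) dv < ∞` are equivalent. -/
theorem stmt5 (α β : ℝ) (hα : 0 < α) (hβ : 0 ≤ β)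
    (pi : Measure ℝ)
    (hpi : IntegrableOn (fun ℓ => min ℓ (ℓ ^ 2)) (Set.Ioi 0) pi)
    (hnontriv : 0 < β ∨ pi (Set.Ioo 0 1) = ⊤)
    (ψ : ℝ → ℝ)
    (hψ : ∀ l : ℝ, ψ l = α * l + β * l ^ 2 +
      ∫ ℓ in Set.Ioi (0 : ℝ), (Real.exp (-l * ℓ) - 1 + l * ℓ) ∂pi) :
    IntegrableOn (fun ℓ => ℓ * Real.log ℓ) (Set.Ioi 1) pi
      ↔ IntegrableOn (fun v => 1 / (α * v) - 1 / ψ v) (Set.Ioc 0 1) := by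
  have := aux_sfinite pi hpi
  have hμ : ∀ᵐ l ∂(pi.restrict (Ioi 0)), (0:ℝ) < l := ae_restrict_mem measurableSet_Ioi
  rw [aux_log pi hpi, aux_tonelli (pi.restrict (Ioi 0)) hμ hpi]
  set μ := pi.restrict (Ioi (0:ℝ)) with hμdef
  have hpi' : Integrable (fun ℓ => min ℓ (ℓ ^ 2)) μ := hpi
  set H : ℝ → ℝ := fun v => ∫ l, l ^ 2 / (1 + v * l) ∂μ with hH
  set φ : ℝ → ℝ := fun v => ∫ l, (Real.exp (-v * l) - 1 + v * l) ∂μ with hφ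
  have hHm : StronglyMeasurable H := by
    apply StronglyMeasurable.integral_prod_right (f := fun v l : ℝ => l ^ 2 / (1 + v * l))
    apply Measurable.stronglyMeasurable
    simp only [Function.uncurry_def]
    fun_prop
  have hφm : StronglyMeasurable φ := by
    apply StronglyMeasurable.integral_prod_right
      (f := fun v l : ℝ => Real.exp (-v * l) - 1 + v * l)
    apply Measurable.stronglyMeasurable
    simp only [Function.uncurry_def]
    fun_prop
  have hψ' : ψ = fun v => α * v + β * v ^ 2 + φ v := funext hψ
  have hφm' : Measurable φ := hφm.measurable
  have hψm : Measurable ψ := by rw [hψ']; fun_prop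
  set C := ∫ l, min l (l ^ 2) ∂μ with hC
  have hC0 : 0 ≤ C := by
    apply integral_nonneg_of_ae
    filter_upwards [hμ] with l hl
    simp only [Pi.zero_apply]
    positivity
  have hFint : ∀ v ∈ Ioc (0:ℝ) 1, Integrable (fun l => l ^ 2 / (1 + v * l)) μ := by
    intro v hv
    apply (hpi'.div_const v).mono' (Measurable.aestronglyMeasurable (by fun_prop))
    filter_upwards [hμ] with l hl
    have := mul_pos hv.1 hl
    rw [Real.norm_of_nonneg (by positivity)]
    exact aux_bd v l hv.1 hv.2 hl
  have hfnn : ∀ u : ℝ, 0 ≤ Real.exp (-u) - 1 + u := fun u => by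
    linarith [Real.add_one_le_exp (-u)]
  have hfint : ∀ v ∈ Ioc (0:ℝ) 1, Integrable (fun l => Real.exp (-v * l) - 1 + v * l) μ := by
    intro v hv
    apply ((hFint v hv).const_mul (v ^ 2)).mono' (Measurable.aestronglyMeasurable (by fun_prop))
    filter_upwards [hμ] with l hl
    have h := aux_up (v * l) (mul_pos hv.1 hl).le
    have h' := hfnn (v * l)
    rw [neg_mul, Real.norm_of_nonneg h']
    calc _ ≤ _ := h
      _ = _ := by ring
  have hHC : ∀ v ∈ Ioc (0:ℝ) 1, H v ≤ C / v := by
    intro v hv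
    rw [hC, ← integral_div]
    apply integral_mono_ae (hFint v hv) (hpi'.div_const v)
    filter_upwards [hμ] with l hl
    exact aux_bd v l hv.1 hv.2 hl
  have hφH : ∀ v ∈ Ioc (0:ℝ) 1, φ v ≤ v ^ 2 * H v := by
    intro v hv
    rw [hH, ← integral_const_mul]
    apply integral_mono_ae (hfint v hv) ((hFint v hv).const_mul _)
    filter_upwards [hμ] with l hl
    have h := aux_up (v * l) (mul_pos hv.1 hl).le
    rw [neg_mul]
    calc _ ≤ _ := h
      _ = _ := by ring
  have hHφ : ∀ v ∈ Ioc (0:ℝ) 1, v ^ 2 * H v ≤ 4 * φ v := by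
    intro v hv
    rw [hH, hφ, ← integral_const_mul, ← integral_const_mul]
    apply integral_mono_ae ((hFint v hv).const_mul _) ((hfint v hv).const_mul _)
    filter_upwards [hμ] with l hl
    have h := aux_low (v * l) (mul_pos hv.1 hl).le
    rw [neg_mul]
    calc _ = (v * l) ^ 2 / (1 + v * l) := by ring
      _ ≤ _ := h
  have hH0 : ∀ v ∈ Ioc (0:ℝ) 1, 0 ≤ H v := by
    intro v hv
    apply integral_nonneg_of_ae
    filter_upwards [hμ] with l hl
    have := mul_pos hv.1 hl
    simp only [Pi.zero_apply]
    positivity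
  have hφ0 : ∀ v ∈ Ioc (0:ℝ) 1, 0 ≤ φ v := by
    intro v hv
    have := hHφ v hv
    have := mul_nonneg (sq_nonneg v) (hH0 v hv)
    linarith
  have hψlow : ∀ v ∈ Ioc (0:ℝ) 1, α * v ≤ ψ v := by
    intro v hv
    rw [hψ']
    have := hφ0 v hv
    have := mul_nonneg hβ (sq_nonneg v)
    simp only
    linarith
  have hψup : ∀ v ∈ Ioc (0:ℝ) 1, ψ v ≤ (α + β + C) * v := by
    intro v hv
    rw [hψ']
    have h1 := hφH v hv
    have h2 := hHC v hv
    rw [le_div_iff₀ hv.1] at h2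
    have h3 : v ^ 2 * H v ≤ C * v := by nlinarith [hv.1]
    have h4 : β * v ^ 2 ≤ β * v := by
      apply mul_le_mul_of_nonneg_left _ hβ
      nlinarith [hv.1, hv.2]
    simp only
    linarith
  have hD : ∀ v ∈ Ioc (0:ℝ) 1, 1 / (α * v) - 1 / ψ v = (β * v ^ 2 + φ v) / (α * v * ψ v) := by
    intro v hv
    have h0 : 0 < α * v := mul_pos hα hv.1
    have h1 : 0 < ψ v := h0.trans_le (hψlow v hv)
    rw [div_sub_div _ _ h0.ne' h1.ne']
    congr 1
    rw [hψ']
    simp only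
    ring
  have hmem : ∀ᵐ v ∂(volume.restrict (Ioc (0:ℝ) 1)), v ∈ Ioc (0:ℝ) 1 :=
    ae_restrict_mem measurableSet_Ioc
  constructor
  · intro h
    have hb : Integrable (fun v => (β + H v) / α ^ 2) (volume.restrict (Ioc (0:ℝ) 1)) :=
      ((integrable_const β).add h).div_const _
    apply hb.mono' (Measurable.aestronglyMeasurable (by fun_prop))
    filter_upwards [hmem] with v hv
    have hv0 := hv.1
    have h0 : 0 < α * v := mul_pos hα hv.1
    have h1 : 0 < ψ v := h0.trans_le (hψlow v hv)
    have h2 := hφ0 v hv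
    rw [hD v hv, Real.norm_of_nonneg (by positivity)]
    calc (β * v ^ 2 + φ v) / (α * v * ψ v)
        ≤ (β * v ^ 2 + v ^ 2 * H v) / (α * v * (α * v)) := by
          have := hφH v hv
          have := hψlow v hv
          have := hH0 v hv
          gcongr
      _ = _ := by field_simp
  · intro h
    have hb := h.const_mul (4 * α * (α + β + C))
    apply Integrable.mono' hb hHm.aestronglyMeasurable
    filter_upwards [hmem] with v hv
    have hv0 := hv.1
    have h0 : 0 < α * v := mul_pos hα hv.1
    have h1 : 0 < ψ v := h0.trans_le (hψlow v hv)
    have h2 := hφ0 v hv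
    rw [hD v hv, Real.norm_of_nonneg (hH0 v hv)]
    have hK : 0 < α + β + C := by linarith
    calc H v = 4 * α * (α + β + C) * ((v ^ 2 * H v / 4) / (α * v * ((α + β + C) * v))) := by
          field_simp
      _ ≤ _ := by
          have h3 : v ^ 2 * H v / 4 ≤ β * v ^ 2 + φ v := by
            have := hHφ v hv
            have := mul_nonneg hβ (sq_nonneg v)
            linarith
          have := hψup v hv
          gcongr
end

section
/- For every λ > 0, the integral ∫_0^∞ ψ̃'(u(λ,s)) ds is finite if and only if ∫_0^1 (1/(αv) − 1/ψ(v)) dv < ∞. In particular, finiteness of ∫_0^∞ ψ̃'(u(λ,s)) ds for one λ > 0 implies its finiteness for all λ > 0. (This is the analytic statement that the stationary continuous-state branching process Z is almost surely finite if and only if condition (A2) holds, since E[e^{−λZ}] = exp(−∫_0^∞ ψ̃'(u(λ,s)) ds).) -/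
open MeasureTheory Set Filter intervalIntegral

lemma aux_nonneg (y : ℝ) : 0 ≤ Real.exp (-y) - 1 + y := by
  have := Real.add_one_le_exp (-y); linarith

lemma aux_le (y : ℝ) : Real.exp (-y) - 1 + y ≤ y * (1 - Real.exp (-y)) := by
  have h1 := Real.add_one_le_exp y
  have h2 : Real.exp (-y) * Real.exp y = 1 := by rw [← Real.exp_add]; simp
  have h3 := Real.exp_pos (-y)
  nlinarith

lemma aux_two (y : ℝ) (hy : 0 ≤ y) :
    y * (1 - Real.exp (-y)) ≤ 2 * (Real.exp (-y) - 1 + y) := by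
  have hd : ∀ x : ℝ, HasDerivAt (fun x : ℝ => 2 * (Real.exp (-x) - 1 + x) - x * (1 - Real.exp (-x)))
      (1 - Real.exp (-x) * (1 + x)) x := by
    intro x
    have he : HasDerivAt (fun x : ℝ => Real.exp (-x)) (Real.exp (-x) * (-1)) x :=
      (hasDerivAt_id x).neg.exp
    have := (((he.sub_const 1).add (hasDerivAt_id x)).const_mul 2).sub
      ((hasDerivAt_id x).mul (he.const_sub 1))
    exact this.congr_deriv (by simp; ring)
  have hm : Monotone (fun x : ℝ => 2 * (Real.exp (-x) - 1 + x) - x * (1 - Real.exp (-x))) := by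
    apply monotone_of_deriv_nonneg (fun x => (hd x).differentiableAt)
    intro x
    rw [(hd x).deriv]
    have := aux_le x
    linarith
  have := hm hy
  simp at this
  linarith

lemma aux_bd_s8 (x c ℓ : ℝ) (hx : 0 < x) (hxc : x ≤ c) (hl : 0 < ℓ) :
    ℓ * (1 - Real.exp (-x * ℓ)) ≤ (c + 1) * min ℓ (ℓ ^ 2) := by
  have h1 := Real.add_one_le_exp (-x * ℓ)
  have h2 := Real.exp_pos (-x * ℓ)
  have hc : 0 < c := by linarith
  rcases min_cases ℓ (ℓ ^ 2) with h | h <;> rw [h.1]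
  · nlinarith [mul_pos hl h2, mul_pos hc hl]
  · have h3 : ℓ * (1 - Real.exp (-x * ℓ)) ≤ ℓ * (x * ℓ) :=
      mul_le_mul_of_nonneg_left (by linarith) hl.le
    nlinarith [mul_le_mul_of_nonneg_right hxc (sq_nonneg ℓ), sq_nonneg ℓ]

/-- Derivative of the integral part. -/
lemma aux_deriv (pi : Measure ℝ)
    (hpi : IntegrableOn (fun ℓ => min ℓ (ℓ ^ 2)) (Set.Ioi 0) pi) (v : ℝ) (hv : 0 < v) :
    IntegrableOn (fun ℓ => Real.exp (-v * ℓ) - 1 + v * ℓ) (Ioi 0) pi ∧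
    IntegrableOn (fun ℓ => ℓ * (1 - Real.exp (-v * ℓ))) (Ioi 0) pi ∧
    HasDerivAt (fun l => ∫ ℓ in Set.Ioi (0 : ℝ), (Real.exp (-l * ℓ) - 1 + l * ℓ) ∂pi)
      (∫ ℓ in Set.Ioi (0 : ℝ), ℓ * (1 - Real.exp (-v * ℓ)) ∂pi) v := by
  have hint : IntegrableOn (fun ℓ => Real.exp (-v * ℓ) - 1 + v * ℓ) (Ioi 0) pi := by
    refine Integrable.mono' (hpi.const_mul (v * (v + 1))) (by fun_prop) ?_
    filter_upwards [self_mem_ae_restrict measurableSet_Ioi] with ℓ hl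
    have hl : 0 < ℓ := hl
    have e : -v * ℓ = -(v * ℓ) := by ring
    have h1 := aux_nonneg (v * ℓ)
    have h2 := aux_le (v * ℓ)
    have h3 := aux_bd_s8 v v ℓ hv le_rfl hl
    rw [e] at h3 ⊢
    rw [Real.norm_eq_abs, abs_of_nonneg h1]
    nlinarith [mul_le_mul_of_nonneg_left h3 hv.le]
  have key := hasDerivAt_integral_of_dominated_loc_of_deriv_le (μ := pi.restrict (Ioi 0))
    (F := fun l ℓ => Real.exp (-l * ℓ) - 1 + l * ℓ)
    (F' := fun l ℓ => ℓ * (1 - Real.exp (-l * ℓ)))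
    (x₀ := v) (s := Ioo 0 (2 * v)) (bound := fun ℓ => (2 * v + 1) * min ℓ (ℓ ^ 2))
    (Ioo_mem_nhds hv (by linarith)) (Eventually.of_forall fun l => by fun_prop) hint
    (by fun_prop) ?_ (hpi.const_mul _) ?_
  · exact ⟨hint, key.1, key.2⟩
  · filter_upwards [self_mem_ae_restrict measurableSet_Ioi] with ℓ hl x hx
    have hl : 0 < ℓ := hl
    have h3 := aux_bd_s8 x (2 * v) ℓ hx.1 hx.2.le hl
    have h4 : Real.exp (-x * ℓ) ≤ 1 := by
      rw [Real.exp_le_one_iff]; nlinarith [mul_pos hx.1 hl]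
    rw [Real.norm_eq_abs, abs_of_nonneg (mul_nonneg hl.le (by linarith))]
    exact h3
  · refine Eventually.of_forall fun ℓ x _ => ?_
    have e1 : HasDerivAt (fun x : ℝ => -x * ℓ) (-1 * ℓ) x := (hasDerivAt_id x).neg.mul_const ℓ
    have e2 : HasDerivAt (fun x : ℝ => x * ℓ) (1 * ℓ) x := (hasDerivAt_id x).mul_const ℓ
    exact ((e1.exp.sub_const 1).add e2).congr_deriv (by ring)

theorem stmt8 (α β : ℝ) (hα : 0 < α) (hβ : 0 ≤ β)
    (pi : Measure ℝ)
    (hpi : IntegrableOn (fun ℓ => min ℓ (ℓ ^ 2)) (Set.Ioi 0) pi)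
    (hnontriv : 0 < β ∨ pi (Set.Ioo 0 1) = ⊤)
    (ψ : ℝ → ℝ)
    (hψ : ∀ l : ℝ, ψ l = α * l + β * l ^ 2 +
      ∫ ℓ in Set.Ioi (0 : ℝ), (Real.exp (-l * ℓ) - 1 + l * ℓ) ∂pi)
    (u : ℝ → ℝ → ℝ)
    (hu : ∀ l : ℝ, 0 < l → ∀ t : ℝ, 0 ≤ t →
      u l t ∈ Set.Ioc 0 l ∧ (∫ r in (u l t)..l, (ψ r)⁻¹) = t) :
    ∀ l : ℝ, 0 < l →
      (IntegrableOn (fun s => deriv ψ (u l s) - α) (Set.Ioi 0)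
        ↔ IntegrableOn (fun v => 1 / (α * v) - 1 / ψ v) (Set.Ioc 0 1)) := by
  have hder : ∀ v, 0 < v → HasDerivAt ψ (α + 2 * β * v +
      ∫ ℓ in Set.Ioi (0 : ℝ), ℓ * (1 - Real.exp (-v * ℓ)) ∂pi) v := by
    intro v hv
    have h := (aux_deriv pi hpi v hv).2.2
    have e : ψ = fun l => α * l + β * l ^ 2 +
      ∫ ℓ in Set.Ioi (0 : ℝ), (Real.exp (-l * ℓ) - 1 + l * ℓ) ∂pi := funext hψ
    rw [e]
    have h1 : HasDerivAt (fun l : ℝ => α * l + β * l ^ 2) (α + 2 * β * v) v := by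
      exact (((hasDerivAt_id v).const_mul α).add
        (((hasDerivAt_id v).pow 2).const_mul β)).congr_deriv (by simp; ring)
    exact h1.add h
  -- comparison
  have hlow : ∀ v, 0 < v → α * v ≤ ψ v := by
    intro v hv
    rw [hψ]
    have : 0 ≤ ∫ ℓ in Set.Ioi (0 : ℝ), (Real.exp (-v * ℓ) - 1 + v * ℓ) ∂pi := by
      apply MeasureTheory.integral_nonneg
      intro ℓ
      have := aux_nonneg (v * ℓ)
      simpa [neg_mul] using this
    nlinarith [mul_nonneg hβ (sq_nonneg v)]
  have hpos : ∀ v, 0 < v → 0 < ψ v := fun v hv => (mul_pos hα hv).trans_le (hlow v hv)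
  have hc1 : ∀ v, 0 < v → ψ v - α * v ≤ v * (deriv ψ v - α) := by
    intro v hv
    obtain ⟨i1, i2, -⟩ := aux_deriv pi hpi v hv
    rw [(hder v hv).deriv, hψ]
    have : ∫ ℓ in Set.Ioi (0 : ℝ), (Real.exp (-v * ℓ) - 1 + v * ℓ) ∂pi ≤
        ∫ ℓ in Set.Ioi (0 : ℝ), v * (ℓ * (1 - Real.exp (-v * ℓ))) ∂pi := by
      apply MeasureTheory.integral_mono i1 (i2.const_mul v)
      intro ℓ
      have := aux_le (v * ℓ)
      simp only [neg_mul]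
      linarith
    rw [MeasureTheory.integral_const_mul] at this
    nlinarith [mul_nonneg hβ (sq_nonneg v)]
  have hc2 : ∀ v, 0 < v → v * (deriv ψ v - α) ≤ 2 * (ψ v - α * v) := by
    intro v hv
    obtain ⟨i1, i2, -⟩ := aux_deriv pi hpi v hv
    rw [(hder v hv).deriv, hψ]
    have : ∫ ℓ in Set.Ioi (0 : ℝ), v * (ℓ * (1 - Real.exp (-v * ℓ))) ∂pi ≤
        ∫ ℓ in Set.Ioi (0 : ℝ), 2 * (Real.exp (-v * ℓ) - 1 + v * ℓ) ∂pi := by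
      apply setIntegral_mono_on (i2.const_mul v) (i1.const_mul 2) measurableSet_Ioi
      intro ℓ hl
      have := aux_two (v * ℓ) (mul_nonneg hv.le (le_of_lt hl))
      simp only [neg_mul]
      linarith
    rw [MeasureTheory.integral_const_mul, MeasureTheory.integral_const_mul] at this
    nlinarith [mul_nonneg hβ (sq_nonneg v)]
  have hψc : ContinuousOn ψ (Ioi 0) := fun v hv => (hder v hv).continuousAt.continuousWithinAt
  have hic : ContinuousOn (fun v => (ψ v)⁻¹) (Ioi 0) :=
    hψc.inv₀ fun v hv => (hpos v hv).ne'
  have hhc : ContinuousOn (fun v => 1 / (α * v) - 1 / ψ v) (Ioi 0) := by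
    apply ContinuousOn.sub
    · exact continuousOn_const.div (by fun_prop) fun v hv => (mul_pos hα hv).ne'
    · exact continuousOn_const.div hψc fun v hv => (hpos v hv).ne'
  intro l hl
  set F : ℝ → ℝ := fun v => ∫ r in v..l, (ψ r)⁻¹ with hF
  have hii : ∀ a b : ℝ, 0 < a → 0 < b → IntervalIntegrable (fun r => (ψ r)⁻¹) volume a b := by
    intro a b ha hb
    apply ContinuousOn.intervalIntegrable
    apply hic.mono
    intro x hx
    exact (lt_min ha hb).trans_le hx.1
  have hFd : ∀ v, 0 < v → HasDerivAt F (-(ψ v)⁻¹) v := by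
    intro v hv
    refine intervalIntegral.integral_hasDerivAt_left (hii v l hv hl) ?_ ?_
    · exact hic.stronglyMeasurableAtFilter isOpen_Ioi v hv
    · exact hic.continuousAt (Ioi_mem_nhds hv)
  have hanti : StrictAntiOn F (Ioi 0) := by
    apply strictAntiOn_of_deriv_neg (convex_Ioi 0)
    · exact fun v hv => (hFd v hv).continuousAt.continuousWithinAt
    · intro v hv
      rw [interior_Ioi] at hv
      rw [(hFd v hv).deriv]
      have := inv_pos.2 (hpos v hv)
      linarith
  have hFl : F l = 0 := by simp [hF]
  have himg : F '' Ioo 0 l = Ioi 0 := by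
    ext t
    constructor
    · rintro ⟨v, hv, rfl⟩
      have := hanti hv.1 hl hv.2
      rw [hFl] at this
      exact this
    · intro ht
      have ht : 0 < t := ht
      obtain ⟨h1, h2⟩ := hu l hl t ht.le
      refine ⟨u l t, ⟨h1.1, lt_of_le_of_ne h1.2 ?_⟩, h2⟩
      intro h
      have h2' : F (u l t) = t := h2
      rw [h, hFl] at h2'
      linarith
  have huF : ∀ v ∈ Ioo 0 l, u l (F v) = v := by
    intro v hv
    have hp : 0 < F v := by
      have := hanti hv.1 hl hv.2
      rwa [hFl] at this
    obtain ⟨h1, h2⟩ := hu l hl (F v) hp.le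
    exact hanti.injOn h1.1 hv.1 h2
  have step1 : IntegrableOn (fun s => deriv ψ (u l s) - α) (Set.Ioi 0) ↔
      IntegrableOn (fun v => (ψ v)⁻¹ * (deriv ψ v - α)) (Ioo 0 l) := by
    rw [← himg, integrableOn_image_iff_integrableOn_abs_deriv_smul measurableSet_Ioo
      (fun v hv => (hFd v hv.1).hasDerivWithinAt)
      (hanti.injOn.mono fun v hv => hv.1)]
    apply integrableOn_congr_fun _ measurableSet_Ioo
    intro v hv
    simp only [smul_eq_mul, huF v hv, abs_neg]
    rw [abs_of_pos (inv_pos.2 (hpos v hv.1))]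
  have heq : ∀ v, 0 < v → 1 / (α * v) - 1 / ψ v = (ψ v)⁻¹ * ((ψ v - α * v) / (α * v)) := by
    intro v hv
    have := (hpos v hv).ne'
    field_simp
  have hle1 : ∀ v, 0 < v → α * (1 / (α * v) - 1 / ψ v) ≤ (ψ v)⁻¹ * (deriv ψ v - α) := by
    intro v hv
    rw [heq v hv, mul_left_comm]
    apply mul_le_mul_of_nonneg_left _ (inv_pos.2 (hpos v hv)).le
    have : α * ((ψ v - α * v) / (α * v)) = (ψ v - α * v) / v := by field_simp
    rw [this, div_le_iff₀ hv]
    linarith [hc1 v hv]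
  have hle2 : ∀ v, 0 < v → (ψ v)⁻¹ * (deriv ψ v - α) ≤ 2 * α * (1 / (α * v) - 1 / ψ v) := by
    intro v hv
    rw [heq v hv, mul_left_comm]
    apply mul_le_mul_of_nonneg_left _ (inv_pos.2 (hpos v hv)).le
    have : 2 * α * ((ψ v - α * v) / (α * v)) = 2 * (ψ v - α * v) / v := by field_simp
    rw [this, le_div_iff₀ hv]
    linarith [hc2 v hv]
  have hnn : ∀ v, 0 < v → 0 ≤ 1 / (α * v) - 1 / ψ v := by
    intro v hv
    have := one_div_le_one_div_of_le (mul_pos hα hv) (hlow v hv)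
    linarith
  have step2 : IntegrableOn (fun v => (ψ v)⁻¹ * (deriv ψ v - α)) (Ioo 0 l) ↔
      IntegrableOn (fun v => 1 / (α * v) - 1 / ψ v) (Ioo 0 l) := by
    have hsub : Ioo 0 l ⊆ Ioi 0 := fun v hv => hv.1
    constructor
    · intro h
      refine Integrable.mono' (h.const_mul α⁻¹)
        ((hhc.mono hsub).aestronglyMeasurable measurableSet_Ioo) ?_
      filter_upwards [self_mem_ae_restrict measurableSet_Ioo] with v hv
      rw [Real.norm_eq_abs, abs_of_nonneg (hnn v hv.1), inv_mul_eq_div, le_div_iff₀ hα]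
      linarith [hle1 v hv.1]
    · intro h
      refine Integrable.mono' (h.const_mul (2 * α)) ?_ ?_
      · exact ((hic.mono hsub).aestronglyMeasurable measurableSet_Ioo).mul
          (((measurable_deriv ψ).sub_const α).aestronglyMeasurable)
      filter_upwards [self_mem_ae_restrict measurableSet_Ioo] with v hv
      rw [Real.norm_eq_abs, abs_of_nonneg]
      · exact hle2 v hv.1
      · exact (mul_nonneg hα.le (hnn v hv.1)).trans (hle1 v hv.1)
  have ext : ∀ a b : ℝ, 0 < a → IntegrableOn (fun v => 1 / (α * v) - 1 / ψ v) (Ioc 0 a) →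
      IntegrableOn (fun v => 1 / (α * v) - 1 / ψ v) (Ioc 0 b) := by
    intro a b ha h
    have h2 : IntegrableOn (fun v => 1 / (α * v) - 1 / ψ v) (Icc a b) :=
      (hhc.mono fun x hx => ha.trans_le hx.1).integrableOn_Icc
    refine (h.union h2).mono_set ?_
    intro x hx
    rcases le_total x a with hxa | hxa
    · exact Or.inl ⟨hx.1, hxa⟩
    · exact Or.inr ⟨hxa, hx.2⟩
  rw [step1, step2, ← integrableOn_Ioc_iff_integrableOn_Ioo]
  exact ⟨ext l 1 hl, ext 1 l one_pos⟩
end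

section
/- Assume (A1) and (A2). For every s ≥ 0, the map λ ↦ u(λ,s) is differentiable on (0,∞) with ∂_λ u(λ,s) = ψ(u(λ,s))/ψ(λ); moreover, the function λ ↦ ∫_0^∞ ψ̃'(u(λ,s)) ds is differentiable on (0,∞) with derivative ψ̃'(λ)/ψ(λ). (This is the analytic form of the identity E[Z e^{−λZ}] = (ψ̃'(λ)/ψ(λ)) E[e^{−λZ}] for the stationary population size Z.) -/
open MeasureTheory Set Filter intervalIntegral

lemma aux_h_bound {l x : ℝ} (hl : 0 ≤ l) (hx : 0 < x) :
    |x * (1 - Real.exp (-l * x))| ≤ (1 + l) * min x (x ^ 2) := by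
  have h1 := Real.add_one_le_exp (-l * x)
  have h2 : Real.exp (-l * x) ≤ 1 := Real.exp_le_one_iff.2 (by nlinarith [mul_nonneg hl hx.le])
  have h3 := Real.exp_pos (-l * x)
  rw [abs_of_nonneg (mul_nonneg hx.le (by linarith))]
  rw [mul_min_of_nonneg _ _ (by linarith)]
  refine le_min ?_ ?_
  · nlinarith [mul_nonneg hl hx.le, mul_pos hx h3]
  · nlinarith [mul_nonneg hl (sq_nonneg x), mul_le_mul_of_nonneg_left h1 hx.le]

lemma aux_F_bound {l x : ℝ} (hl : 0 ≤ l) (hx : 0 < x) :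
    |Real.exp (-l * x) - 1 + l * x| ≤ (l + l ^ 2) * min x (x ^ 2) := by
  have h1 := Real.add_one_le_exp (-l * x)
  have h2 : Real.exp (-l * x) ≤ 1 := Real.exp_le_one_iff.2 (by nlinarith [mul_nonneg hl hx.le])
  have h3 := Real.exp_pos (-l * x)
  have hlx := mul_nonneg hl hx.le
  have h4 : Real.exp (-l * x) ≤ 1 - l * x + (l * x) ^ 2 := by
    have h5 := Real.add_one_le_exp (l * x)
    have h6 : Real.exp (-l * x) * Real.exp (l * x) = 1 := by
      rw [← Real.exp_add]; simp
    have h7 : Real.exp (-l * x) * (l * x + 1) ≤ 1 := by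
      exact (mul_le_mul_of_nonneg_left h5 h3.le).trans h6.le
    have h8 : 1 ≤ (1 - l * x + (l * x) ^ 2) * (l * x + 1) := by
      nlinarith [pow_nonneg hlx 3]
    exact le_of_mul_le_mul_right (h7.trans h8) (by linarith)
  rw [abs_of_nonneg (by linarith), mul_min_of_nonneg _ _ (by nlinarith)]
  refine le_min ?_ ?_
  · nlinarith [mul_nonneg (sq_nonneg l) hx.le]
  · nlinarith [mul_nonneg hl (sq_nonneg x)]

lemma aux_deriv_s9 (μ : Measure ℝ) (hpos : ∀ᵐ x ∂μ, 0 < x)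
    (hint : Integrable (fun x : ℝ => min x (x ^ 2)) μ) {l : ℝ} (hl : 0 < l) :
    HasDerivAt (fun l => ∫ x, (Real.exp (-l * x) - 1 + l * x) ∂μ)
      (∫ x, x * (1 - Real.exp (-l * x)) ∂μ) l := by
  refine (_root_.hasDerivAt_integral_of_dominated_loc_of_deriv_le (s := Ioo 0 (2 * l))
    (bound := fun x => (1 + 2 * l) * min x (x ^ 2))
    (F' := fun l x => x * (1 - Real.exp (-l * x)))
    (Ioo_mem_nhds hl (by linarith)) ?_ ?_ ?_ ?_ ?_ ?_).2
  · refine Eventually.of_forall fun y => Continuous.aestronglyMeasurable (by fun_prop)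
  · refine (hint.const_mul (l + l ^ 2)).mono' (Continuous.aestronglyMeasurable (by fun_prop)) ?_
    filter_upwards [hpos] with x hx using aux_F_bound hl.le hx
  · exact Continuous.aestronglyMeasurable (by fun_prop)
  · filter_upwards [hpos] with x hx y hy
    refine (aux_h_bound hy.1.le hx).trans ?_
    have : 0 ≤ min x (x ^ 2) := le_min hx.le (sq_nonneg x)
    exact mul_le_mul_of_nonneg_right (by linarith [hy.2]) this
  · exact hint.const_mul _
  · refine Eventually.of_forall fun x y _ => ?_
    have h1 : HasDerivAt (fun y : ℝ => -y * x) (-1 * x) y := (hasDerivAt_id y).neg.mul_const x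
    have h2 : HasDerivAt (fun y : ℝ => y * x) (1 * x) y := (hasDerivAt_id y).mul_const x
    refine ((h1.exp.sub_const 1).add h2).congr_deriv ?_
    ring

lemma aux_cont (μ : Measure ℝ) (hpos : ∀ᵐ x ∂μ, 0 < x)
    (hint : Integrable (fun x : ℝ => min x (x ^ 2)) μ) {l : ℝ} (hl : 0 < l) :
    ContinuousAt (fun l => ∫ x, x * (1 - Real.exp (-l * x)) ∂μ) l := by
  refine continuousAt_of_dominated (bound := fun x => (1 + 2 * l) * min x (x ^ 2)) ?_ ?_ ?_ ?_
  · refine Eventually.of_forall fun y => Continuous.aestronglyMeasurable (by fun_prop)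
  · filter_upwards [Ioo_mem_nhds hl (show l < 2 * l by linarith)] with y hy
    filter_upwards [hpos] with x hx
    refine (aux_h_bound hy.1.le hx).trans ?_
    have : 0 ≤ min x (x ^ 2) := le_min hx.le (sq_nonneg x)
    exact mul_le_mul_of_nonneg_right (by linarith [hy.2]) this
  · exact hint.const_mul _
  · exact Eventually.of_forall fun x => Continuous.continuousAt (by fun_prop)

lemma aux_h_int (μ : Measure ℝ) (hpos : ∀ᵐ x ∂μ, 0 < x)
    (hint : Integrable (fun x : ℝ => min x (x ^ 2)) μ) {l : ℝ} (hl : 0 ≤ l) :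
    Integrable (fun x => x * (1 - Real.exp (-l * x))) μ := by
  refine (hint.const_mul (1 + l)).mono' (Continuous.aestronglyMeasurable (by fun_prop)) ?_
  filter_upwards [hpos] with x hx using aux_h_bound hl hx

lemma aux_inner_int {α c : ℝ} (hα : 0 < α) (hc : 0 ≤ c) (T : ℝ) :
    IntegrableOn (fun s => 1 - Real.exp (-(c * Real.exp (-α * s)))) (Ioi T) := by
  refine ((integrableOn_exp_mul_Ioi (neg_lt_zero.2 hα) T).const_mul c).mono'
    (Continuous.aestronglyMeasurable (by fun_prop)) (Eventually.of_forall fun s => ?_)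
  have h1 := Real.add_one_le_exp (-(c * Real.exp (-α * s)))
  have h0 : 0 ≤ c * Real.exp (-α * s) := mul_nonneg hc (Real.exp_pos _).le
  have h2 : Real.exp (-(c * Real.exp (-α * s))) ≤ 1 := Real.exp_le_one_iff.2 (by linarith)
  rw [Real.norm_of_nonneg (by linarith)]
  linarith

lemma aux_inner {α c T : ℝ} (hα : 0 < α) (hc : 0 ≤ c) (hT : 0 ≤ T) :
    ∫ s in Ioi 0, (1 - Real.exp (-(c * Real.exp (-α * s)))) ≤ T + c * Real.exp (-α * T) / α := by
  rw [← integral_interval_add_Ioi (aux_inner_int hα hc 0) (aux_inner_int hα hc T)]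
  refine add_le_add ?_ ?_
  · have : ∫ s in (0:ℝ)..T, (1 - Real.exp (-(c * Real.exp (-α * s)))) ≤ ∫ s in (0:ℝ)..T, (1:ℝ) := by
      refine integral_mono_on hT (Continuous.intervalIntegrable (by fun_prop) _ _)
        (Continuous.intervalIntegrable (by fun_prop) _ _) fun s _ => ?_
      linarith [Real.exp_pos (-(c * Real.exp (-α * s)))]
    simpa using this
  · have : ∫ s in Ioi T, (1 - Real.exp (-(c * Real.exp (-α * s)))) ≤
        ∫ s in Ioi T, c * Real.exp (-α * s) := by
      refine setIntegral_mono (aux_inner_int hα hc T)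
        ((integrableOn_exp_mul_Ioi (neg_lt_zero.2 hα) T).const_mul c) fun s => ?_
      have h1 := Real.add_one_le_exp (-(c * Real.exp (-α * s)))
      simp only
      linarith
    rw [MeasureTheory.integral_const_mul, integral_exp_mul_Ioi (neg_lt_zero.2 hα)] at this
    refine this.trans_eq ?_
    rw [neg_div_neg_eq, mul_div_assoc]

lemma aux_sfinite_s9 (μ : Measure ℝ) (hpos : ∀ᵐ x ∂μ, 0 < x)
    (hint : Integrable (fun x : ℝ => min x (x ^ 2)) μ) : SFinite μ := by
  have hf := hint.aefinStronglyMeasurable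
  have h0 := hf.ae_eq_zero_compl
  have hs : SigmaFinite (μ.restrict hf.sigmaFiniteSet) := hf.sigmaFinite_restrict
  have hm : MeasurableSet hf.sigmaFiniteSet := hf.measurableSet
  have : ∀ᵐ x ∂μ, x ∈ hf.sigmaFiniteSet := by
    rw [EventuallyEq, ae_restrict_iff' hm.compl] at h0
    filter_upwards [h0, hpos] with x h0 hx
    by_contra hn
    have h1 := h0 hn
    have : 0 < min x (x ^ 2) := lt_min hx (by positivity)
    simp only [Pi.zero_apply] at h1
    linarith
  rw [Measure.restrict_eq_self_of_ae_mem this] at hs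
  infer_instance

lemma aux_tonelli_s9 (μ : Measure ℝ) (hpos : ∀ᵐ x ∂μ, 0 < x)
    (hint : Integrable (fun x : ℝ => min x (x ^ 2)) μ)
    (hA2 : IntegrableOn (fun x => x * Real.log x) (Ioi 1) μ)
    {α L : ℝ} (hα : 0 < α) (hL : 0 < L) :
    IntegrableOn (fun s => ∫ x, x * (1 - Real.exp (-(L * Real.exp (-α * s)) * x)) ∂μ) (Ioi 0) := by
  have := aux_sfinite_s9 μ hpos hint
  have hmeas : AEStronglyMeasurable
      (fun p : ℝ × ℝ => p.2 * (1 - Real.exp (-(L * Real.exp (-α * p.1)) * p.2)))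
      ((volume.restrict (Ioi 0)).prod μ) := Continuous.aestronglyMeasurable (by fun_prop)
  have key : Integrable (fun p : ℝ × ℝ => p.2 * (1 - Real.exp (-(L * Real.exp (-α * p.1)) * p.2)))
      ((volume.restrict (Ioi 0)).prod μ) := by
    rw [integrable_prod_iff' hmeas]
    have e : ∀ s x : ℝ, x * (1 - Real.exp (-(L * Real.exp (-α * s)) * x))
        = x * (1 - Real.exp (-((L * x) * Real.exp (-α * s)))) := by
      intro s x; congr 3; ring
    constructor
    · filter_upwards [hpos] with x hx
      simp only [e]
      exact (aux_inner_int hα (mul_pos hL hx).le 0).const_mul x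
    · have hind : Integrable ((Ioi (1:ℝ)).indicator (fun x => x * Real.log x)) μ :=
        hA2.integrable_indicator measurableSet_Ioi
      refine ((hint.const_mul (L / α)).add (hind.const_mul (1 / α))).mono' ?_ ?_
      · exact hmeas.norm.prod_swap.integral_prod_right'
      · filter_upwards [hpos] with x hx
        rw [Real.norm_of_nonneg (integral_nonneg fun _ => norm_nonneg _)]
        have : ∀ s, ‖x * (1 - Real.exp (-(L * Real.exp (-α * s)) * x))‖ =
            x * (1 - Real.exp (-((L * x) * Real.exp (-α * s)))) := by
          intro s
          rw [e, Real.norm_of_nonneg]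
          have : Real.exp (-((L * x) * Real.exp (-α * s))) ≤ 1 :=
            Real.exp_le_one_iff.2 (by have : 0 < L * x * Real.exp (-α * s) := by positivity
                                      linarith)
          exact mul_nonneg hx.le (by linarith)
        simp only [this, Pi.add_apply]
        rw [MeasureTheory.integral_const_mul]
        rcases le_or_gt x 1 with h1 | h1
        · rw [indicator_of_notMem (by simpa using h1), min_eq_right (by nlinarith)]
          have := aux_inner (α := α) (c := L * x) (T := 0) hα (by positivity) le_rfl
          refine (mul_le_mul_of_nonneg_left this hx.le).trans_eq ?_
          simp; ring
        · rw [indicator_of_mem (by simpa using h1), min_eq_left (by nlinarith)]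
          have := aux_inner (α := α) (c := L * x) (T := Real.log x / α) hα (by positivity)
            (div_nonneg (Real.log_nonneg h1.le) hα.le)
          refine (mul_le_mul_of_nonneg_left this hx.le).trans_eq ?_
          have e2 : -α * (Real.log x / α) = - Real.log x := by field_simp
          rw [e2, Real.exp_neg, Real.exp_log hx]
          field_simp
          ring
  exact key.integral_prod_left

section flow
variable {α : ℝ} {ψ : ℝ → ℝ} {u : ℝ → ℝ → ℝ}

lemma flow_ii (hc : ∀ x, 0 < x → ContinuousAt ψ x) (hp : ∀ x, 0 < x → 0 < ψ x)
    {a b : ℝ} (ha : 0 < a) (hb : 0 < b) :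
    IntervalIntegrable (fun r => (ψ r)⁻¹) volume a b := by
  refine ContinuousOn.intervalIntegrable fun x hx => ?_
  have hx0 : 0 < x := lt_of_lt_of_le (lt_min ha hb) hx.1
  exact ((hc x hx0).inv₀ (hp x hx0).ne').continuousWithinAt

lemma flow_pos (hc : ∀ x, 0 < x → ContinuousAt ψ x) (hp : ∀ x, 0 < x → 0 < ψ x)
    {a b : ℝ} (ha : 0 < a) (hab : a < b) : 0 < ∫ r in a..b, (ψ r)⁻¹ :=
  intervalIntegral_pos_of_pos_on (flow_ii hc hp ha (ha.trans hab))
    (fun x hx => inv_pos.2 (hp x (ha.trans hx.1))) hab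

lemma flow_inj (hc : ∀ x, 0 < x → ContinuousAt ψ x) (hp : ∀ x, 0 < x → 0 < ψ x)
    {a b c : ℝ} (ha : 0 < a) (hb : 0 < b) (hc0 : 0 < c)
    (h : ∫ r in a..c, (ψ r)⁻¹ = ∫ r in b..c, (ψ r)⁻¹) : a = b := by
  have h1 := integral_add_adjacent_intervals (flow_ii hc hp ha hb) (flow_ii hc hp hb hc0)
  have h2 := integral_symm (μ := volume) (f := fun r => (ψ r)⁻¹) a b
  rcases lt_trichotomy a b with hab | hab | hab
  · have := flow_pos hc hp ha hab
    linarith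
  · exact hab
  · have := flow_pos hc hp hb hab
    linarith

lemma flow_left (hc : ∀ x, 0 < x → ContinuousAt ψ x) (hp : ∀ x, 0 < x → 0 < ψ x)
    (hu : ∀ l : ℝ, 0 < l → ∀ t : ℝ, 0 ≤ t →
      u l t ∈ Set.Ioc 0 l ∧ (∫ r in (u l t)..l, (ψ r)⁻¹) = t)
    {x m : ℝ} (hx : 0 < x) (hxm : x ≤ m) : u m (∫ r in x..m, (ψ r)⁻¹) = x := by
  have h0 : 0 ≤ ∫ r in x..m, (ψ r)⁻¹ := by
    rcases hxm.eq_or_lt with h | h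
    · simp [h]
    · exact (flow_pos hc hp hx h).le
  have hm := hx.trans_le hxm
  obtain ⟨h1, h2⟩ := hu m hm _ h0
  exact flow_inj hc hp h1.1 hx hm h2

lemma flow_semi (hc : ∀ x, 0 < x → ContinuousAt ψ x) (hp : ∀ x, 0 < x → 0 < ψ x)
    (hu : ∀ l : ℝ, 0 < l → ∀ t : ℝ, 0 ≤ t →
      u l t ∈ Set.Ioc 0 l ∧ (∫ r in (u l t)..l, (ψ r)⁻¹) = t)
    {m L s : ℝ} (hm : 0 < m) (hmL : m ≤ L) (hs : 0 ≤ s) :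
    u m s = u L ((∫ r in m..L, (ψ r)⁻¹) + s) := by
  obtain ⟨h1, h2⟩ := hu m hm s hs
  have h3 := flow_left hc hp hu h1.1 (h1.2.trans hmL)
  rw [← integral_add_adjacent_intervals (flow_ii hc hp h1.1 hm)
    (flow_ii hc hp hm (hm.trans_le hmL)), h2, add_comm] at h3
  exact h3.symm

lemma flow_G (hc : ∀ x, 0 < x → ContinuousAt ψ x) (hp : ∀ x, 0 < x → 0 < ψ x)
    {x L : ℝ} (hx : 0 < x) (hL : 0 < L) :
    HasStrictDerivAt (fun y => ∫ r in y..L, (ψ r)⁻¹) (-(ψ x)⁻¹) x := by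
  have hco : ContinuousOn (fun r => (ψ r)⁻¹) (Ioi 0) := fun y hy =>
    ((hc y hy).inv₀ (hp y hy).ne').continuousWithinAt
  exact integral_hasStrictDerivAt_left (flow_ii hc hp hx hL)
    (hco.stronglyMeasurableAtFilter isOpen_Ioi x hx) ((hc x hx).inv₀ (hp x hx).ne')

lemma flow_deriv (hc : ∀ x, 0 < x → ContinuousAt ψ x) (hp : ∀ x, 0 < x → 0 < ψ x)
    (hu : ∀ l : ℝ, 0 < l → ∀ t : ℝ, 0 ≤ t →
      u l t ∈ Set.Ioc 0 l ∧ (∫ r in (u l t)..l, (ψ r)⁻¹) = t)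
    {L t : ℝ} (hL : 0 < L) (ht : 0 < t) : HasDerivAt (u L) (-ψ (u L t)) t := by
  obtain ⟨h1, h2⟩ := hu L hL t ht.le
  have hlt : u L t < L := by
    refine lt_of_le_of_ne h1.2 fun h => ?_
    rw [h] at h2; simp at h2; linarith
  have hG := flow_G hc hp h1.1 hL
  have := hG.to_local_left_inverse (neg_ne_zero.2 (inv_ne_zero (hp _ h1.1).ne')) (g := u L) (by
    filter_upwards [Ioo_mem_nhds h1.1 hlt] with y hy
    exact flow_left hc hp hu hy.1 hy.2.le)
  simp only [h2] at this
  exact this.hasDerivAt.congr_deriv (by rw [inv_neg, inv_inv])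

lemma flow_bound (hα : 0 < α) (hc : ∀ x, 0 < x → ContinuousAt ψ x)
    (hlb : ∀ x, 0 < x → α * x ≤ ψ x)
    (hu : ∀ l : ℝ, 0 < l → ∀ t : ℝ, 0 ≤ t →
      u l t ∈ Set.Ioc 0 l ∧ (∫ r in (u l t)..l, (ψ r)⁻¹) = t)
    {L s : ℝ} (hL : 0 < L) (hs : 0 ≤ s) : u L s ≤ L * Real.exp (-α * s) := by
  have hp : ∀ x, 0 < x → 0 < ψ x := fun x hx => (mul_pos hα hx).trans_le (hlb x hx)
  obtain ⟨h1, h2⟩ := hu L hL s hs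
  have h3 : ∫ r in (u L s)..L, (ψ r)⁻¹ ≤ ∫ r in (u L s)..L, α⁻¹ * r⁻¹ := by
    refine integral_mono_on h1.2 (flow_ii hc hp h1.1 hL) ?_ fun r hr => ?_
    · refine ContinuousOn.intervalIntegrable fun x hx => ?_
      have hx0 : 0 < x := lt_of_lt_of_le (lt_min h1.1 hL) hx.1
      exact (continuousAt_const.mul (continuousAt_inv₀ hx0.ne')).continuousWithinAt
    · have hr0 := h1.1.trans_le hr.1
      rw [← mul_inv]
      exact inv_anti₀ (mul_pos hα hr0) (hlb r hr0)
  rw [intervalIntegral.integral_const_mul, integral_inv_of_pos h1.1 hL, h2] at h3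
  have h4 : α * s ≤ Real.log (L / u L s) := by
    rw [inv_mul_eq_div, le_div_iff₀ hα] at h3; linarith
  rw [Real.le_log_iff_exp_le (div_pos hL h1.1), le_div_iff₀ h1.1] at h4
  rw [neg_mul, Real.exp_neg, ← div_eq_mul_inv, le_div_iff₀ (Real.exp_pos _)]
  linarith

end flow

/-- Under (A1) and (A2), for every `s ≥ 0` the map `λ ↦ u(λ,s)` is
differentiable on `(0,∞)` with derivative `ψ(u(λ,s))/ψ(λ)`; moreover
`λ ↦ ∫_0^∞ ψ̃'(u(λ,s)) ds` is differentiable on `(0,∞)` with derivative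
`ψ̃'(λ)/ψ(λ)`, where `ψ̃'(x) = ψ'(x) − α`. -/
theorem stmt9 (α β : ℝ) (hα : 0 < α) (hβ : 0 ≤ β)
    (pi : Measure ℝ)
    (hpi : IntegrableOn (fun ℓ => min ℓ (ℓ ^ 2)) (Set.Ioi 0) pi)
    (hnontriv : 0 < β ∨ pi (Set.Ioo 0 1) = ⊤)
    (ψ : ℝ → ℝ)
    (hψ : ∀ l : ℝ, ψ l = α * l + β * l ^ 2 +
      ∫ ℓ in Set.Ioi (0 : ℝ), (Real.exp (-l * ℓ) - 1 + l * ℓ) ∂pi)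
    (u : ℝ → ℝ → ℝ)
    (hu : ∀ l : ℝ, 0 < l → ∀ t : ℝ, 0 ≤ t →
      u l t ∈ Set.Ioc 0 l ∧ (∫ r in (u l t)..l, (ψ r)⁻¹) = t)
    (hA1 : IntegrableOn (fun v => (ψ v)⁻¹) (Set.Ioi 1))
    (hA2 : IntegrableOn (fun ℓ => ℓ * Real.log ℓ) (Set.Ioi 1) pi) :
    (∀ s : ℝ, 0 ≤ s → ∀ l : ℝ, 0 < l →
      HasDerivAt (fun m => u m s) (ψ (u l s) / ψ l) l)
    ∧ (∀ l : ℝ, 0 < l →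
        HasDerivAt (fun m => ∫ s in Set.Ioi (0 : ℝ), (deriv ψ (u m s) - α))
          ((deriv ψ l - α) / ψ l) l) := by
  have hpos : ∀ᵐ x ∂(pi.restrict (Ioi 0)), 0 < x := ae_restrict_mem measurableSet_Ioi
  have hint : Integrable (fun x : ℝ => min x (x ^ 2)) (pi.restrict (Ioi 0)) := hpi
  have hA2' : IntegrableOn (fun x => x * Real.log x) (Ioi 1) (pi.restrict (Ioi 0)) := by
    rw [IntegrableOn, Measure.restrict_restrict measurableSet_Ioi,
      inter_eq_left.2 (Ioi_subset_Ioi zero_le_one)]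
    exact hA2
  generalize pi.restrict (Ioi 0) = μ at *
  have hd : ∀ x, 0 < x → HasDerivAt ψ
      (α + 2 * β * x + ∫ y, y * (1 - Real.exp (-x * y)) ∂μ) x := by
    intro x hx
    rw [funext hψ]
    have h1 : HasDerivAt (fun l : ℝ => α * l + β * l ^ 2) (α + 2 * β * x) x := by
      refine (((hasDerivAt_id x).const_mul α).add ((hasDerivAt_pow 2 x).const_mul β)).congr_deriv ?_
      simp; ring
    exact h1.add (aux_deriv_s9 μ hpos hint hx)
  have hc : ∀ x, 0 < x → ContinuousAt ψ x := fun x hx => (hd x hx).continuousAt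
  have hlb : ∀ x, 0 < x → α * x ≤ ψ x := by
    intro x hx
    rw [hψ]
    have h1 : 0 ≤ ∫ y, (Real.exp (-x * y) - 1 + x * y) ∂μ :=
      integral_nonneg fun y => by
        have := Real.add_one_le_exp (-x * y)
        simp only [Pi.zero_apply]
        linarith
    nlinarith [mul_nonneg hβ (sq_nonneg x)]
  have hp : ∀ x, 0 < x → 0 < ψ x := fun x hx => (mul_pos hα hx).trans_le (hlb x hx)
  have hGpos : ∀ m L : ℝ, 0 < m → m < L → 0 < ∫ r in m..L, (ψ r)⁻¹ := fun m L hm hmL =>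
    flow_pos hc hp hm hmL
  refine ⟨fun s hs l hl => ?_, fun l hl => ?_⟩
  · have hL : 0 < l + 1 := by linarith
    have hG := (flow_G hc hp hl hL).hasDerivAt.add_const s
    have ht : 0 < (∫ r in l..(l + 1), (ψ r)⁻¹) + s :=
      add_pos_of_pos_of_nonneg (hGpos _ _ hl (by linarith)) hs
    have h1 := HasDerivAt.comp l (flow_deriv hc hp hu hL ht) hG
    rw [← flow_semi hc hp hu hl (by linarith) hs] at h1
    refine (h1.congr_of_eventuallyEq ?_).congr_deriv (by rw [neg_mul_neg, div_eq_mul_inv])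
    filter_upwards [Ioo_mem_nhds hl (show l < l + 1 by linarith)] with m hm
    exact flow_semi hc hp hu hm.1 hm.2.le hs
  · have hL : 0 < l + 1 := by linarith
    set L := l + 1 with hLdef
    have hlL : l < L := by linarith
    have hder : ∀ x, 0 < x → deriv ψ x - α =
        2 * β * x + ∫ y, y * (1 - Real.exp (-x * y)) ∂μ := by
      intro x hx; rw [(hd x hx).deriv]; ring
    have hdc : ∀ x, 0 < x → ContinuousAt (fun x => deriv ψ x - α) x := by
      intro x hx
      have : ContinuousAt (fun x => 2 * β * x + ∫ y, y * (1 - Real.exp (-x * y)) ∂μ) x :=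
        (continuousAt_const.mul continuousAt_id).add (aux_cont μ hpos hint hx)
      refine this.congr ?_
      filter_upwards [Ioi_mem_nhds hx] with y hy using (hder y hy).symm
    have hkc : ∀ t, 0 < t → ContinuousAt (fun t => deriv ψ (u L t) - α) t := fun t ht =>
      ContinuousAt.comp (f := u L) (g := fun x => deriv ψ x - α)
        (hdc _ (hu L hL t ht.le).1.1) (flow_deriv hc hp hu hL ht).continuousAt
    have hkco : ContinuousOn (fun t => deriv ψ (u L t) - α) (Ioi 0) := fun t ht =>
      (hkc t ht).continuousWithinAt
    have hki : IntegrableOn (fun t => deriv ψ (u L t) - α) (Ioi 0) := by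
      have hb := (((integrableOn_exp_mul_Ioi (neg_lt_zero.2 hα) 0).const_mul (2 * β * L)).add
        (aux_tonelli_s9 μ hpos hint hA2' hα hL))
      refine hb.mono' (hkco.aestronglyMeasurable measurableSet_Ioi) ?_
      filter_upwards [ae_restrict_mem measurableSet_Ioi] with t ht
      have hut := (hu L hL t (le_of_lt ht)).1.1
      have hub := flow_bound hα hc hlb hu hL (le_of_lt ht)
      rw [hder _ hut, Real.norm_of_nonneg]
      · refine add_le_add ?_ ?_
        · beta_reduce
          rw [mul_assoc (2 * β)]
          exact mul_le_mul_of_nonneg_left hub (by linarith)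
        · refine integral_mono_ae (aux_h_int μ hpos hint hut.le)
            (aux_h_int μ hpos hint (hut.le.trans hub)) ?_
          filter_upwards [hpos] with y hy
          refine mul_le_mul_of_nonneg_left (sub_le_sub_left (Real.exp_le_exp.2 ?_) _) hy.le
          exact mul_le_mul_of_nonneg_right (neg_le_neg hub) hy.le
      · refine add_nonneg (by positivity) (integral_nonneg_of_ae ?_)
        filter_upwards [hpos] with y hy
        have : Real.exp (-u L t * y) ≤ 1 :=
          Real.exp_le_one_iff.2 (by have := mul_pos hut hy; linarith)
        exact mul_nonneg hy.le (by linarith)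
    have hG := (flow_G hc hp hl hL).hasDerivAt
    have ht := hGpos l L hl hlL
    have hI : HasDerivAt (fun t => ∫ s in (0:ℝ)..t, (deriv ψ (u L s) - α))
        (deriv ψ (u L (∫ r in l..L, (ψ r)⁻¹)) - α) (∫ r in l..L, (ψ r)⁻¹) := by
      refine integral_hasDerivAt_right ?_ (hkco.stronglyMeasurableAtFilter isOpen_Ioi _ ht)
        (hkc _ ht)
      rw [intervalIntegrable_iff_integrableOn_Ioc_of_le ht.le]
      exact hki.mono_set Ioc_subset_Ioi_self
    have h1 := (HasDerivAt.comp l hI hG).const_sub (∫ s in Ioi (0:ℝ), (deriv ψ (u L s) - α))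
    rw [flow_left hc hp hu hl hlL.le] at h1
    refine (h1.congr_of_eventuallyEq ?_).congr_deriv (by rw [mul_neg, neg_neg, div_eq_mul_inv])
    filter_upwards [Ioo_mem_nhds hl hlL] with m hm
    have hm0 := hGpos m L hm.1 hm.2
    simp only [Function.comp_apply]
    rw [← integral_Ioi_sub_Ioi hki hm0.le, sub_sub_cancel]
    have e1 : ∫ s in Ioi (0:ℝ), (deriv ψ (u m s) - α) =
        ∫ s in Ioi (0:ℝ), (deriv ψ (u L ((∫ r in m..L, (ψ r)⁻¹) + s)) - α) := by
      refine setIntegral_congr_fun measurableSet_Ioi fun s hs => ?_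
      rw [flow_semi hc hp hu hm.1 hm.2.le (le_of_lt hs)]
    rw [e1]
    generalize (∫ r in m..L, (ψ r)⁻¹) = g
    rw [← (measurePreserving_add_left volume g).setIntegral_preimage_emb
      (measurableEmbedding_addLeft g) (fun s => deriv ψ (u L s) - α) (Ioi g)]
    simp
end

section
/- Assume (A1) and (A2). Then: (a) there exists κ_* ∈ (0,∞) such that lim_{t→∞} c(t) e^{αt} = κ_*; (b) for every λ ∈ (0,∞), lim_{t→∞} u(λ,t)/c(t) = e^{−α c^{−1}(λ)}, where c^{−1} denotes the inverse function of c. -/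
open MeasureTheory Set Filter intervalIntegral

lemma g_nonneg (x : ℝ) : 0 ≤ Real.exp (-x) - 1 + x := by
  have := Real.add_one_le_exp (-x); linarith

lemma g_le_id {x : ℝ} (hx : 0 ≤ x) : Real.exp (-x) - 1 + x ≤ x := by
  have : Real.exp (-x) ≤ 1 := Real.exp_le_one_iff.2 (by linarith)
  linarith

lemma g_le_sq {x : ℝ} (hx : 0 ≤ x) : Real.exp (-x) - 1 + x ≤ x ^ 2 := by
  by_cases h : x ≤ 1
  · have := Real.abs_exp_sub_one_sub_id_le (x := -x) (by rw [abs_neg, abs_of_nonneg hx]; exact h)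
    have h2 := (abs_le.1 this).2
    have h3 : (-x) ^ 2 = x ^ 2 := by ring
    rw [h3] at h2
    linarith
  · have := g_le_id hx
    nlinarith

lemma g_mono {x y : ℝ} (hx : 0 ≤ x) (hxy : x ≤ y) :
    Real.exp (-x) - 1 + x ≤ Real.exp (-y) - 1 + y := by
  have h1 : Real.exp (-y) = Real.exp (-x) * Real.exp (-(y - x)) := by
    rw [← Real.exp_add]; congr 1; ring
  have h2 := Real.add_one_le_exp (-(y-x))
  have h3 : Real.exp (-x) ≤ 1 := Real.exp_le_one_iff.2 (by linarith)
  have h4 := Real.exp_pos (-x)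
  rw [h1]
  nlinarith

lemma pi_sfinite (pi : Measure ℝ)
    (hpi : IntegrableOn (fun ℓ => min ℓ (ℓ ^ 2)) (Set.Ioi 0) pi) :
    SFinite (pi.restrict (Ioi 0)) := by
  have hf := Integrable.aefinStronglyMeasurable hpi
  have h0 := hf.ae_eq_zero_compl
  have hpos : ∀ᵐ x ∂(pi.restrict (Ioi (0:ℝ))), 0 < min x (x^2) := by
    filter_upwards [ae_restrict_mem measurableSet_Ioi] with x hx
    have : (0:ℝ) < x := hx
    positivity
  have h1 : ∀ᵐ x ∂(pi.restrict (Ioi (0:ℝ))), x ∈ hf.sigmaFiniteSet := by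
    have := (ae_restrict_iff' hf.measurableSet.compl).1 h0
    filter_upwards [this, hpos] with x hx hp
    by_contra hn
    have := hx hn
    simp only [Pi.zero_apply] at this
    linarith
  have h2 := Measure.restrict_eq_self_of_ae_mem h1
  have h3 := hf.sigmaFinite_restrict
  rw [h2] at h3
  infer_instance

lemma g_integrable (pi : Measure ℝ)
    (hpi : IntegrableOn (fun ℓ => min ℓ (ℓ ^ 2)) (Set.Ioi 0) pi) {l : ℝ} (hl : 0 ≤ l) :
    IntegrableOn (fun ℓ => Real.exp (-l * ℓ) - 1 + l * ℓ) (Ioi 0) pi := by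
  refine Integrable.mono' (hpi.const_mul (max l (l^2))) (by fun_prop) ?_
  filter_upwards [ae_restrict_mem measurableSet_Ioi] with x hx
  have hx : (0:ℝ) < x := hx
  have hlx : 0 ≤ l * x := by positivity
  rw [neg_mul, Real.norm_of_nonneg (g_nonneg _)]
  have h1 := g_le_id hlx
  have h2 := g_le_sq hlx
  rcases le_total x (x^2) with h | h
  · rw [min_eq_left h]
    exact h1.trans (mul_le_mul_of_nonneg_right (le_max_left _ _) hx.le)
  · rw [min_eq_right h]
    refine h2.trans ?_
    rw [mul_pow]
    exact (mul_le_mul_of_nonneg_right (le_max_right _ _) (by positivity))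

lemma inner_bound {ℓ : ℝ} (hℓ : 0 < ℓ) :
    ∫⁻ r in Ioc (0:ℝ) 1, ENNReal.ofReal ((Real.exp (-r * ℓ) - 1 + r * ℓ) / r ^ 2)
      ≤ ENNReal.ofReal (min ℓ (ℓ^2) + (Ioi (1:ℝ)).indicator (fun ℓ => ℓ * Real.log ℓ) ℓ) := by
  have hsq : ∀ r : ℝ, 0 < r → (Real.exp (-r * ℓ) - 1 + r * ℓ) / r ^ 2 ≤ ℓ ^ 2 := by
    intro r hr
    rw [div_le_iff₀ (by positivity), neg_mul]
    have := g_le_sq (x := r * ℓ) (by positivity)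
    rw [mul_pow] at this; linarith
  have hid : ∀ r : ℝ, 0 < r → (Real.exp (-r * ℓ) - 1 + r * ℓ) / r ^ 2 ≤ ℓ * r⁻¹ := by
    intro r hr
    rw [div_le_iff₀ (by positivity), neg_mul]
    have := g_le_id (x := r * ℓ) (by positivity)
    refine this.trans (le_of_eq ?_)
    field_simp
  by_cases h : ℓ ≤ 1
  · have hn : ℓ ∉ Ioi (1:ℝ) := by simpa using h
    rw [indicator_of_notMem hn, add_zero, min_eq_right (by nlinarith)]
    calc _ ≤ ∫⁻ r in Ioc (0:ℝ) 1, ENNReal.ofReal (ℓ^2) :=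
          setLIntegral_mono measurable_const
            (fun r hr => ENNReal.ofReal_le_ofReal (hsq r hr.1))
      _ = _ := by simp
  · push Not at h
    have hm : ℓ ∈ Ioi (1:ℝ) := h
    have hlog : 0 ≤ ℓ * Real.log ℓ := mul_nonneg hℓ.le (Real.log_nonneg h.le)
    have hinv : ℓ⁻¹ ≤ 1 := inv_le_one_of_one_le₀ h.le
    have hinv0 : 0 < ℓ⁻¹ := by positivity
    rw [indicator_of_mem hm, min_eq_left (by nlinarith), ENNReal.ofReal_add hℓ.le hlog]
    rw [← Ioc_union_Ioc_eq_Ioc hinv0.le hinv]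
    refine (lintegral_union_le _ _ _).trans (add_le_add ?_ ?_)
    · calc _ ≤ ∫⁻ r in Ioc (0:ℝ) ℓ⁻¹, ENNReal.ofReal (ℓ^2) :=
          setLIntegral_mono measurable_const
            (fun r hr => ENNReal.ofReal_le_ofReal (hsq r hr.1))
        _ = ENNReal.ofReal ℓ := by
          simp only [lintegral_const, Measure.restrict_apply, MeasurableSet.univ, univ_inter,
            Real.volume_Ioc, sub_zero]
          rw [← ENNReal.ofReal_mul (by positivity)]
          congr 1; field_simp
    · have hii : IntegrableOn (fun r : ℝ => ℓ * r⁻¹) (Ioc ℓ⁻¹ 1) := by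
        rw [← intervalIntegrable_iff_integrableOn_Ioc_of_le hinv]
        refine (intervalIntegral.intervalIntegrable_inv ?_ continuousOn_id).const_mul _
        intro x hx
        rw [uIcc_of_le hinv] at hx
        exact (hinv0.trans_le hx.1).ne'
      calc _ ≤ ∫⁻ r in Ioc (ℓ⁻¹) 1, ENNReal.ofReal (ℓ * r⁻¹) :=
          setLIntegral_mono (by fun_prop)
            (fun r hr => ENNReal.ofReal_le_ofReal (hid r (hinv0.trans hr.1)))
        _ = ENNReal.ofReal (ℓ * Real.log ℓ) := by
          rw [← ofReal_integral_eq_lintegral_ofReal hii, ← intervalIntegral.integral_of_le hinv,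
            intervalIntegral.integral_const_mul, integral_inv_of_pos hinv0 one_pos]
          · simp
          · filter_upwards [ae_restrict_mem measurableSet_Ioc] with r hr
            have : 0 < r := hinv0.trans hr.1
            simp only [Pi.zero_apply]
            positivity
      
lemma phi_mono (pi : Measure ℝ)
    (hpi : IntegrableOn (fun ℓ => min ℓ (ℓ ^ 2)) (Set.Ioi 0) pi) :
    MonotoneOn (fun l : ℝ => ∫ ℓ in Ioi (0:ℝ), (Real.exp (-l * ℓ) - 1 + l * ℓ) ∂pi) (Ici 0) := by
  intro a ha b hb hab
  refine setIntegral_mono_on (g_integrable pi hpi ha) (g_integrable pi hpi hb) measurableSet_Ioi ?_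
  intro x hx
  have hx : (0:ℝ) < x := hx
  have ha : (0:ℝ) ≤ a := ha
  rw [neg_mul, neg_mul]
  exact g_mono (by positivity) (by gcongr)

lemma phi_nonneg (pi : Measure ℝ) (l : ℝ) :
    0 ≤ ∫ ℓ in Ioi (0:ℝ), (Real.exp (-l * ℓ) - 1 + l * ℓ) ∂pi :=
  integral_nonneg (fun x => by simpa [neg_mul] using g_nonneg (l * x))

lemma phi_int (pi : Measure ℝ)
    (hpi : IntegrableOn (fun ℓ => min ℓ (ℓ ^ 2)) (Set.Ioi 0) pi)
    (hA2 : IntegrableOn (fun ℓ => ℓ * Real.log ℓ) (Set.Ioi 1) pi) :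
    IntegrableOn (fun r : ℝ => (∫ ℓ in Ioi (0:ℝ), (Real.exp (-r * ℓ) - 1 + r * ℓ) ∂pi) / r ^ 2)
      (Ioc 0 1) := by
  have hs := pi_sfinite pi hpi
  have hmeas : AEMeasurable (fun r : ℝ =>
      (∫ ℓ in Ioi (0:ℝ), (Real.exp (-r * ℓ) - 1 + r * ℓ) ∂pi) / r ^ 2)
      (volume.restrict (Ioc 0 1)) := by
    refine AEMeasurable.div ?_ (by fun_prop)
    exact aemeasurable_restrict_of_monotoneOn measurableSet_Ioc
      ((phi_mono pi hpi).mono (fun x hx => hx.1.le))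
  have hB : IntegrableOn (fun ℓ => min ℓ (ℓ^2) +
      (Ioi (1:ℝ)).indicator (fun ℓ => ℓ * Real.log ℓ) ℓ) (Ioi 0) pi := by
    refine hpi.add ?_
    exact ((integrable_indicator_iff measurableSet_Ioi).2 hA2).integrableOn
  refine ⟨hmeas.aestronglyMeasurable, ?_⟩
  rw [hasFiniteIntegral_iff_ofReal
    (Eventually.of_forall fun r => div_nonneg (phi_nonneg pi r) (sq_nonneg r))]
  calc _ = ∫⁻ r in Ioc (0:ℝ) 1, ∫⁻ ℓ in Ioi (0:ℝ),
        ENNReal.ofReal ((Real.exp (-r * ℓ) - 1 + r * ℓ) / r ^ 2) ∂pi := by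
        refine setLIntegral_congr_fun measurableSet_Ioc ?_
        intro r hr
        simp only
        rw [← MeasureTheory.integral_div, ofReal_integral_eq_lintegral_ofReal]
        · exact (g_integrable pi hpi hr.1.le).div_const _
        · refine Eventually.of_forall fun x => div_nonneg ?_ (sq_nonneg r)
          simpa [neg_mul] using g_nonneg (r * x)
    _ = ∫⁻ ℓ in Ioi (0:ℝ), ∫⁻ r in Ioc (0:ℝ) 1,
        ENNReal.ofReal ((Real.exp (-r * ℓ) - 1 + r * ℓ) / r ^ 2) ∂volume ∂pi := by
        refine lintegral_lintegral_swap (Measurable.aemeasurable ?_)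
        unfold Function.uncurry
        fun_prop
    _ ≤ ∫⁻ ℓ in Ioi (0:ℝ), ENNReal.ofReal (min ℓ (ℓ^2) +
          (Ioi (1:ℝ)).indicator (fun ℓ => ℓ * Real.log ℓ) ℓ) ∂pi := by
        refine lintegral_mono_ae ?_
        filter_upwards [ae_restrict_mem measurableSet_Ioi] with x hx
        exact inner_bound hx
    _ < ⊤ := hB.lintegral_lt_top

lemma inv_anti {ψ : ℝ → ℝ} {α : ℝ} (hα : 0 < α) (hlow : ∀ r, 0 < r → α * r ≤ ψ r)
    (hmono : MonotoneOn ψ (Ioi 0)) : AntitoneOn (fun r => (ψ r)⁻¹) (Ioi 0) := by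
  intro a ha b hb hab
  have h1 := hlow a ha
  have h2 : 0 < α * a := mul_pos hα ha
  exact inv_anti₀ (by linarith) (hmono ha hb hab)

lemma inv_ii {ψ : ℝ → ℝ} {α : ℝ} (hα : 0 < α) (hlow : ∀ r, 0 < r → α * r ≤ ψ r)
    (hmono : MonotoneOn ψ (Ioi 0)) {a b : ℝ} (ha : 0 < a) (hb : 0 < b) :
    IntervalIntegrable (fun r => (ψ r)⁻¹) volume a b := by
  refine AntitoneOn.intervalIntegrable ((inv_anti hα hlow hmono).mono ?_)
  intro x hx
  exact (lt_min ha hb).trans_le hx.1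

lemma inv_int {ψ : ℝ → ℝ} {α : ℝ} (hα : 0 < α) (hlow : ∀ r, 0 < r → α * r ≤ ψ r)
    (hmono : MonotoneOn ψ (Ioi 0)) (hA1 : IntegrableOn (fun v => (ψ v)⁻¹) (Set.Ioi 1))
    {a : ℝ} (ha : 0 < a) : IntegrableOn (fun v => (ψ v)⁻¹) (Ioi a) := by
  rcases le_total 1 a with h | h
  · exact hA1.mono_set (Ioi_subset_Ioi h)
  · rw [← Ioc_union_Ioi_eq_Ioi h]
    refine IntegrableOn.union ?_ hA1
    rw [← intervalIntegrable_iff_integrableOn_Ioc_of_le h]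
    exact inv_ii hα hlow hmono ha one_pos

lemma main_tendsto {ψ : ℝ → ℝ} {α : ℝ} (hα : 0 < α) (hlow : ∀ r, 0 < r → α * r ≤ ψ r)
    (hmono : MonotoneOn ψ (Ioi 0)) (hA1 : IntegrableOn (fun v => (ψ v)⁻¹) (Set.Ioi 1))
    (hh : IntegrableOn (fun r => (α * r)⁻¹ - (ψ r)⁻¹) (Ioc 0 1)) :
    ∃ K : ℝ, Tendsto (fun x => (∫ v in Ioi x, (ψ v)⁻¹) + Real.log x / α)
      (nhdsWithin 0 (Ioi 0)) (nhds K) := by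
  refine ⟨(∫ v in Ioi (1:ℝ), (ψ v)⁻¹) - ∫ r in (0:ℝ)..1, ((α * r)⁻¹ - (ψ r)⁻¹), ?_⟩
  have hc : ContinuousOn (fun x => ∫ r in x..1, ((α * r)⁻¹ - (ψ r)⁻¹)) (uIcc 0 1) := by
    refine continuousOn_primitive_interval_left ?_
    rw [uIcc_of_le zero_le_one, integrableOn_Icc_iff_integrableOn_Ioc]
    exact hh
  have h0 : Tendsto (fun x => ∫ r in x..1, ((α * r)⁻¹ - (ψ r)⁻¹)) (nhdsWithin 0 (Ioi 0))
      (nhds (∫ r in (0:ℝ)..1, ((α * r)⁻¹ - (ψ r)⁻¹))) := by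
    have := hc 0 (by simp)
    refine Tendsto.mono_left this ?_
    rw [uIcc_of_le zero_le_one, nhdsWithin_Icc_eq_nhdsGE zero_lt_one]
    exact nhdsWithin_mono _ Ioi_subset_Ici_self
  refine (tendsto_const_nhds.sub h0).congr' ?_
  filter_upwards [self_mem_nhdsWithin] with x hx
  have hx : (0:ℝ) < x := hx
  have hinv : IntervalIntegrable (fun r : ℝ => (α * r)⁻¹) volume x 1 := by
    refine intervalIntegral.intervalIntegrable_inv ?_ (by fun_prop)
    intro y hy
    have : 0 < y := (lt_min hx one_pos).trans_le hy.1
    positivity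
  rw [intervalIntegral.integral_sub hinv (inv_ii hα hlow hmono hx one_pos)]
  have h1 := intervalIntegral.integral_interval_add_Ioi (inv_int hα hlow hmono hA1 hx) hA1
  have h2 : ∫ r in x..1, (α * r)⁻¹ = - (Real.log x / α) := by
    simp_rw [mul_inv]
    rw [intervalIntegral.integral_const_mul, integral_inv_of_pos hx one_pos, one_div, Real.log_inv]
    ring
  rw [h2, ← h1]
  ring

lemma final_tendsto {ψ : ℝ → ℝ} {α K : ℝ} (hα : 0 < α) (hlow : ∀ r, 0 < r → α * r ≤ ψ r)
    (hmono : MonotoneOn ψ (Ioi 0)) (hA1 : IntegrableOn (fun v => (ψ v)⁻¹) (Set.Ioi 1))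
    (hK : Tendsto (fun x => (∫ v in Ioi x, (ψ v)⁻¹) + Real.log x / α)
      (nhdsWithin 0 (Ioi 0)) (nhds K))
    (x : ℝ → ℝ) (s : ℝ) (hx : ∀ᶠ t in atTop, 0 < x t ∧ (∫ v in Ioi (x t), (ψ v)⁻¹) = t + s) :
    Tendsto (fun t => x t * Real.exp (α * t)) atTop (nhds (Real.exp (α * (K - s)))) := by
  have hx0 : Tendsto x atTop (nhdsWithin 0 (Ioi 0)) := by
    rw [tendsto_nhdsWithin_iff]
    refine ⟨?_, hx.mono fun t ht => ht.1⟩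
    refine tendsto_order.2 ⟨fun a ha => hx.mono fun t ht => ha.trans ht.1, fun a ha => ?_⟩
    filter_upwards [hx, eventually_gt_atTop ((∫ v in Ioi a, (ψ v)⁻¹) - s)] with t ht h2
    by_contra hn
    push Not at hn
    have : (∫ v in Ioi (x t), (ψ v)⁻¹) ≤ ∫ v in Ioi a, (ψ v)⁻¹ := by
      refine setIntegral_mono_set (inv_int hα hlow hmono hA1 ha) ?_
        (Ioi_subset_Ioi hn).eventuallyLE
      filter_upwards [ae_restrict_mem measurableSet_Ioi] with r hr
      have hr : 0 < r := ha.trans hr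
      have := hlow r hr
      have : 0 < α * r := by positivity
      exact inv_nonneg.2 (by linarith)
    linarith [ht.2]
  have h1 := hK.comp hx0
  have h2 := (h1.sub_const s).const_mul α
  refine ((Real.continuous_exp.tendsto _).comp h2).congr' ?_
  filter_upwards [hx] with t ht
  simp only [Function.comp]
  rw [ht.2]
  have : α * (t + s + Real.log (x t) / α - s) = Real.log (x t) + α * t := by
    field_simp; ring
  rw [this, Real.exp_add, Real.exp_log ht.1]

/-- Under (A1) and (A2): (a) there exists `κ_* ∈ (0,∞)` with
`lim_{t→∞} c(t) e^{αt} = κ_*`; (b) for every `λ > 0`,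
`lim_{t→∞} u(λ,t)/c(t) = e^{−α c⁻¹(λ)}`. -/
theorem stmt10 (α β : ℝ) (hα : 0 < α) (hβ : 0 ≤ β)
    (pi : Measure ℝ)
    (hpi : IntegrableOn (fun ℓ => min ℓ (ℓ ^ 2)) (Set.Ioi 0) pi)
    (hnontriv : 0 < β ∨ pi (Set.Ioo 0 1) = ⊤)
    (ψ : ℝ → ℝ)
    (hψ : ∀ l : ℝ, ψ l = α * l + β * l ^ 2 +
      ∫ ℓ in Set.Ioi (0 : ℝ), (Real.exp (-l * ℓ) - 1 + l * ℓ) ∂pi)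
    (u : ℝ → ℝ → ℝ)
    (hu : ∀ l : ℝ, 0 < l → ∀ t : ℝ, 0 ≤ t →
      u l t ∈ Set.Ioc 0 l ∧ (∫ r in (u l t)..l, (ψ r)⁻¹) = t)
    (hA1 : IntegrableOn (fun v => (ψ v)⁻¹) (Set.Ioi 1))
    (hA2 : IntegrableOn (fun ℓ => ℓ * Real.log ℓ) (Set.Ioi 1) pi)
    (c : ℝ → ℝ)
    (hc : ∀ t : ℝ, 0 < t →
      c t ∈ Set.Ioi (0 : ℝ) ∧ (∫ v in Set.Ioi (c t), (ψ v)⁻¹) = t)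
    (cinv : ℝ → ℝ)
    (hcinv : ∀ l : ℝ, 0 < l → 0 < cinv l ∧ c (cinv l) = l) :
    (∃ κ : ℝ, 0 < κ ∧
        Tendsto (fun t => c t * Real.exp (α * t)) atTop (nhds κ))
    ∧ (∀ l : ℝ, 0 < l →
        Tendsto (fun t => u l t / c t) atTop (nhds (Real.exp (-α * cinv l)))) := by
  have hφ0 := phi_nonneg pi
  have hlow : ∀ r, 0 < r → α * r ≤ ψ r := by
    intro r hr
    rw [hψ]
    have := hφ0 r
    have : 0 ≤ β * r ^ 2 := by positivity
    linarith
  have hmono : MonotoneOn ψ (Ioi 0) := by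
    intro a ha b hb hab
    have ha : (0:ℝ) < a := ha
    rw [hψ, hψ]
    have h1 := phi_mono pi hpi (mem_Ici.2 (le_of_lt ha)) (mem_Ici.2 (le_of_lt (mem_Ioi.1 hb))) hab
    simp only at h1
    gcongr
  have hh : IntegrableOn (fun r => (α * r)⁻¹ - (ψ r)⁻¹) (Ioc 0 1) := by
    have hb : IntegrableOn (fun r : ℝ => (α ^ 2)⁻¹ * (β +
        (∫ ℓ in Ioi (0:ℝ), (Real.exp (-r * ℓ) - 1 + r * ℓ) ∂pi) / r ^ 2)) (Ioc 0 1) :=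
      (Integrable.add (integrable_const β) (phi_int pi hpi hA2)).const_mul _
    refine Integrable.mono' hb ?_ ?_
    · refine AEMeasurable.aestronglyMeasurable (AEMeasurable.sub (by fun_prop) ?_)
      exact aemeasurable_restrict_of_antitoneOn measurableSet_Ioc
        ((inv_anti hα hlow hmono).mono fun x hx => hx.1)
    · filter_upwards [ae_restrict_mem measurableSet_Ioc] with r hr
      have hr : 0 < r := hr.1
      have h1 := hlow r hr
      have h2 : 0 < α * r := by positivity
      have h3 : 0 < ψ r := by linarith
      have h4 : 0 ≤ (α * r)⁻¹ - (ψ r)⁻¹ := sub_nonneg.2 (inv_anti₀ h2 h1)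
      rw [Real.norm_of_nonneg h4, inv_sub_inv h2.ne' h3.ne']
      have h5 : 0 ≤ ψ r - α * r := by linarith
      calc (ψ r - α * r) / (α * r * ψ r) ≤ (ψ r - α * r) / (α * r * (α * r)) := by gcongr
        _ = _ := by
          rw [hψ r]
          field_simp
          ring
  obtain ⟨K, hK⟩ := main_tendsto hα hlow hmono hA1 hh
  have hA := final_tendsto hα hlow hmono hA1 hK c 0 (by
    filter_upwards [eventually_gt_atTop 0] with t ht
    exact ⟨(hc t ht).1, by rw [(hc t ht).2, add_zero]⟩)
  refine ⟨⟨_, Real.exp_pos _, hA⟩, ?_⟩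
  intro l hl
  have hF : (∫ v in Ioi l, (ψ v)⁻¹) = cinv l := by
    have h1 := (hc _ (hcinv l hl).1).2
    rwa [(hcinv l hl).2] at h1
  have hB := final_tendsto hα hlow hmono hA1 hK (u l) (cinv l) (by
    filter_upwards [eventually_ge_atTop 0] with t ht
    obtain ⟨h1, h2⟩ := hu l hl t ht
    refine ⟨h1.1, ?_⟩
    rw [← intervalIntegral.integral_interval_add_Ioi (inv_int hα hlow hmono hA1 h1.1)
      (inv_int hα hlow hmono hA1 hl), h2, hF])
  have hD := hB.div hA (Real.exp_pos _).ne'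
  rw [← Real.exp_sub] at hD
  have he : α * (K - cinv l) - α * (K - 0) = -α * cinv l := by ring
  rw [he] at hD
  refine hD.congr fun t => ?_
  exact mul_div_mul_right _ _ (Real.exp_pos _).ne'
end

section
/- The function x ↦ ψ̃'(x)/x is nonincreasing on (0,∞). Consequently, assuming (A1) and ψ''(0+) < ∞, the function t ↦ ψ''(0) c(t) / ψ̃'(c(t)) is nonincreasing on (0,∞). (The latter quantity equals E[N^A | A = t], the conditional expectation of the number of oldest families given that the time to the most recent common ancestor equals t.) -/
open MeasureTheory Set Filter

/-- The function `x ↦ ψ̃'(x)/x` is nonincreasing on `(0,∞)`, where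
`ψ̃'(x) = 2βx + ∫_{(0,∞)} ℓ(1 − e^{−xℓ}) π(dℓ)`. Consequently, under (A1) and if
`ψ''(0+) = 2β + ∫_{(0,∞)} ℓ² π(dℓ) < ∞`, the function
`t ↦ ψ''(0) c(t) / ψ̃'(c(t))` is nonincreasing on `(0,∞)`. -/
theorem stmt15 (α β : ℝ) (hα : 0 < α) (hβ : 0 ≤ β)
    (pi : Measure ℝ)
    (hpi : IntegrableOn (fun ℓ => min ℓ (ℓ ^ 2)) (Set.Ioi 0) pi)
    (hnontriv : 0 < β ∨ pi (Set.Ioo 0 1) = ⊤)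
    (ψ : ℝ → ℝ)
    (hψ : ∀ l : ℝ, ψ l = α * l + β * l ^ 2 +
      ∫ ℓ in Set.Ioi (0 : ℝ), (Real.exp (-l * ℓ) - 1 + l * ℓ) ∂pi)
    (tψ' : ℝ → ℝ)
    (htψ' : ∀ x : ℝ, tψ' x = 2 * β * x +
      ∫ ℓ in Set.Ioi (0 : ℝ), ℓ * (1 - Real.exp (-x * ℓ)) ∂pi)
    (hA1 : IntegrableOn (fun v => (ψ v)⁻¹) (Set.Ioi 1))
    (c : ℝ → ℝ)
    (hc : ∀ t : ℝ, 0 < t →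
      c t ∈ Set.Ioi (0 : ℝ) ∧ (∫ v in Set.Ioi (c t), (ψ v)⁻¹) = t) :
    AntitoneOn (fun x => tψ' x / x) (Set.Ioi 0)
    ∧ (IntegrableOn (fun ℓ => ℓ ^ 2) (Set.Ioi 0) pi →
        AntitoneOn
          (fun t => (2 * β + ∫ ℓ in Set.Ioi (0 : ℝ), ℓ ^ 2 ∂pi) * c t / tψ' (c t))
          (Set.Ioi 0)) := by
  have hint : ∀ x : ℝ, 0 < x →
      IntegrableOn (fun ℓ : ℝ => ℓ * (1 - Real.exp (-x * ℓ))) (Set.Ioi 0) pi := by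
    intro x hx
    refine Integrable.mono' (hpi.const_mul (max 1 x)) ?_ ?_
    · exact Measurable.aestronglyMeasurable (by fun_prop)
    · filter_upwards [ae_restrict_mem measurableSet_Ioi] with l hl
      have hl : 0 < l := hl
      have h1 : Real.exp (-x * l) ≤ 1 := Real.exp_le_one_iff.mpr (by nlinarith)
      have h2 : -x * l + 1 ≤ Real.exp (-x * l) := Real.add_one_le_exp _
      have h3 := Real.exp_pos (-x * l)
      rw [Real.norm_of_nonneg (mul_nonneg hl.le (by linarith))]
      rcases le_total l (l ^ 2) with h | h
      · rw [min_eq_left h]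
        have : 1 ≤ max 1 x := le_max_left _ _
        nlinarith
      · rw [min_eq_right h]
        have : x ≤ max 1 x := le_max_right _ _
        have h4 : l * (1 - Real.exp (-x * l)) ≤ l * (x * l) :=
          mul_le_mul_of_nonneg_left (by linarith) hl.le
        nlinarith [sq_nonneg l]
  have hpt : ∀ x y l : ℝ, 0 < x → x ≤ y → 0 < l →
      x * (1 - Real.exp (-y * l)) ≤ y * (1 - Real.exp (-x * l)) := by
    intro x y l hx hxy hl
    have hy : 0 < y := by linarith
    have h := convexOn_exp.2 (mem_univ (0 : ℝ)) (mem_univ (-y * l))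
      (show 0 ≤ 1 - x / y by rw [sub_nonneg, div_le_one hy]; exact hxy)
      (show 0 ≤ x / y by positivity) (by ring)
    simp only [smul_eq_mul, mul_zero, zero_add, Real.exp_zero, mul_one] at h
    have e : x / y * (-y * l) = -x * l := by field_simp
    rw [e] at h
    have h' := mul_le_mul_of_nonneg_left h hy.le
    have e2 : y * (1 - x / y + x / y * Real.exp (-y * l)) = y - x + x * Real.exp (-y * l) := by
      field_simp
    rw [e2] at h'
    linarith
  have hanti : AntitoneOn (fun x => tψ' x / x) (Set.Ioi 0) := by
    intro x hx y hy hxy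
    have hx : 0 < x := hx
    have hy : 0 < y := hy
    simp only
    rw [div_le_div_iff₀ hy hx, htψ' x, htψ' y]
    have : (∫ ℓ in Set.Ioi (0 : ℝ), x * (ℓ * (1 - Real.exp (-y * ℓ))) ∂pi) ≤
        ∫ ℓ in Set.Ioi (0 : ℝ), y * (ℓ * (1 - Real.exp (-x * ℓ))) ∂pi := by
      refine setIntegral_mono_on ((hint y hy).const_mul x) ((hint x hx).const_mul y)
        measurableSet_Ioi ?_
      intro l hl
      have := mul_le_mul_of_nonneg_left (hpt x y l hx hxy hl) (le_of_lt hl)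
      linarith
    rw [integral_const_mul, integral_const_mul] at this
    nlinarith
  refine ⟨hanti, fun _ => ?_⟩
  have hppos : ∀ x l : ℝ, 0 < x → 0 < l → 0 < l * (1 - Real.exp (-x * l)) := by
    intro x l hx hl
    have h1 : Real.exp (-x * l) < 1 := Real.exp_lt_one_iff.mpr (by nlinarith [mul_pos hx hl])
    exact mul_pos hl (by linarith)
  have hpos : ∀ x : ℝ, 0 < x → 0 < tψ' x := by
    intro x hx
    rw [htψ' x]
    have h0 : 0 ≤ ∫ ℓ in Set.Ioi (0 : ℝ), ℓ * (1 - Real.exp (-x * ℓ)) ∂pi :=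
      setIntegral_nonneg measurableSet_Ioi fun l hl => (hppos x l hx hl).le
    rcases hnontriv with h | h
    · have : 0 < 2 * β * x := by positivity
      linarith
    · have h1 : 0 < ∫ ℓ in Set.Ioi (0 : ℝ), ℓ * (1 - Real.exp (-x * ℓ)) ∂pi := by
        rw [setIntegral_pos_iff_support_of_nonneg_ae _ (hint x hx)]
        · have hsub : Set.Ioo (0 : ℝ) 1 ⊆
              Function.support (fun ℓ : ℝ => ℓ * (1 - Real.exp (-x * ℓ))) ∩ Set.Ioi 0 :=
            fun l hl => ⟨(hppos x l hx hl.1).ne', hl.1⟩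
          exact lt_of_lt_of_le (by rw [h]; exact ENNReal.zero_lt_top) (measure_mono hsub)
        · filter_upwards [ae_restrict_mem measurableSet_Ioi] with l hl
          exact (hppos x l hx hl).le
      have : 0 ≤ 2 * β * x := by positivity
      linarith
  have hψ0 : ∀ v : ℝ, 0 < v → 0 ≤ ψ v := by
    intro v hv
    rw [hψ v]
    have : 0 ≤ ∫ ℓ in Set.Ioi (0 : ℝ), (Real.exp (-v * ℓ) - 1 + v * ℓ) ∂pi := by
      refine integral_nonneg fun l => ?_
      have := Real.add_one_le_exp (-v * l)
      simp only [Pi.zero_apply]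
      linarith
    positivity
  intro s hs t ht hst
  have hs : 0 < s := hs
  have ht : 0 < t := ht
  obtain ⟨hcs, his⟩ := hc s hs
  obtain ⟨hct, hit⟩ := hc t ht
  have hcc : c t ≤ c s := by
    rcases hst.eq_or_lt with rfl | hlt
    · exact le_rfl
    by_contra! hcon
    have hI : IntegrableOn (fun v => (ψ v)⁻¹) (Set.Ioi (c s)) := by
      by_contra hn
      have := integral_undef hn
      linarith
    have := setIntegral_mono_set (s := Set.Ioi (c t)) hI (by
      filter_upwards [ae_restrict_mem measurableSet_Ioi] with v hv
      exact inv_nonneg.mpr (hψ0 v (lt_trans hcs hv)))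
      (Set.Ioi_subset_Ioi hcon.le).eventuallyLE
    linarith
  have hg := hanti hct hcs hcc
  have hcs : 0 < c s := hcs
  have hct : 0 < c t := hct
  have hK : 0 ≤ 2 * β + ∫ ℓ in Set.Ioi (0 : ℝ), ℓ ^ 2 ∂pi := by
    have : 0 ≤ ∫ ℓ in Set.Ioi (0 : ℝ), ℓ ^ 2 ∂pi := integral_nonneg fun l => sq_nonneg l
    positivity
  simp only at hg ⊢
  rw [div_le_div_iff₀ hcs hct] at hg
  rw [mul_div_assoc, mul_div_assoc]
  refine mul_le_mul_of_nonneg_left ?_ hK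
  rw [div_le_div_iff₀ (hpos _ hct) (hpos _ hcs)]
  linarith
end

section
/- Let ψ(λ) = βλ² + 2βθλ with β > 0 and θ > 0, so ψ̃'(λ) = 2βλ and u(λ,s) = 2θλ/((2θ+λ)e^{2θβs} − λ). Then for every λ ≥ 0, exp( −∫_0^∞ ψ̃'(u(λ,s)) ds ) = ( 2θ / (2θ + λ) )². Consequently, the stationary population size Z, whose Laplace transform is E[e^{−λZ}] = exp(−∫_0^∞ ψ̃'(u(λ,s)) ds), is distributed as (e₁ + e₂)/(2θ) where e₁, e₂ are independent exponential random variables with mean 1; that is, the right-hand side equals ∫_0^∞ e^{−λz} (2θ)² z e^{−2θz} dz, the Laplace transform of the Gamma(2, 2θ) distribution. -/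
open MeasureTheory Set Filter

/-- For the quadratic mechanism `ψ(λ) = βλ² + 2βθλ`, with
`ψ̃'(λ) = 2βλ` and `u(λ,s) = 2θλ/((2θ+λ)e^{2θβs} − λ)`, for every `λ ≥ 0`:
`exp( −∫_0^∞ 2β u(λ,s) ds ) = (2θ/(2θ+λ))²`, and this equals
`∫_0^∞ e^{−λz} (2θ)² z e^{−2θz} dz`, the Laplace transform of the Gamma(2, 2θ)
distribution (so the stationary size `Z` is `(e₁+e₂)/(2θ)`). -/
theorem stmt17 (β θ : ℝ) (hβ : 0 < β) (hθ : 0 < θ)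
    (u : ℝ → ℝ → ℝ)
    (hu : ∀ l s : ℝ,
      u l s = 2 * θ * l / ((2 * θ + l) * Real.exp (2 * θ * β * s) - l)) :
    ∀ l : ℝ, 0 ≤ l →
      Real.exp (-∫ s in Set.Ioi (0 : ℝ), 2 * β * u l s) = (2 * θ / (2 * θ + l)) ^ 2
      ∧ (2 * θ / (2 * θ + l)) ^ 2 =
          ∫ z in Set.Ioi (0 : ℝ),
            Real.exp (-l * z) * ((2 * θ) ^ 2 * z * Real.exp (-2 * θ * z)) := by
  intro l hl
  have hp : 0 < 2 * θ + l := by linarith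
  have ha : 0 < 2 * θ * β := by positivity
  constructor
  · have hE : ∀ s : ℝ, 0 ≤ s → Real.exp (-(2 * θ * β * s)) ≤ 1 := fun s hs => by
      rw [Real.exp_le_one_iff]
      have := mul_nonneg ha.le hs
      linarith
    have hD : ∀ s : ℝ, 0 ≤ s → 0 < (2 * θ + l) - l * Real.exp (-(2 * θ * β * s)) := fun s hs => by
      have := mul_le_mul_of_nonneg_left (hE s hs) hl
      linarith
    have hform : ∀ s : ℝ, 0 ≤ s → 2 * β * u l s =
        2 * (l * (2 * θ * β * Real.exp (-(2 * θ * β * s))) /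
          ((2 * θ + l) - l * Real.exp (-(2 * θ * β * s)))) := fun s hs => by
      rw [hu]
      have h1 := hD s hs
      have he : Real.exp (2 * θ * β * s) = (Real.exp (-(2 * θ * β * s)))⁻¹ := by
        rw [Real.exp_neg, inv_inv]
      have hpos := Real.exp_pos (-(2 * θ * β * s))
      rw [he]
      generalize Real.exp (-(2 * θ * β * s)) = x at *
      have h2 : (2 * θ + l) * x⁻¹ - l = ((2 * θ + l) - l * x) / x := by
        field_simp
      rw [h2]
      have h3 := h1.ne'
      rw [div_div_eq_mul_div]
      ring
    have hlim : Tendsto (fun s : ℝ => 2 * Real.log ((2 * θ + l) - l * Real.exp (-(2 * θ * β * s))))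
        atTop (nhds (2 * Real.log (2 * θ + l))) := by
      have h0 : Tendsto (fun s : ℝ => Real.exp (-(2 * θ * β * s))) atTop (nhds 0) :=
        Real.tendsto_exp_neg_atTop_nhds_zero.comp (tendsto_id.const_mul_atTop ha)
      have h1 := (tendsto_const_nhds (x := 2 * θ + l)).sub (h0.const_mul l)
      rw [mul_zero, sub_zero] at h1
      exact (h1.log hp.ne').const_mul 2
    have hint := integral_Ioi_of_hasDerivAt_of_nonneg' (a := (0:ℝ))
      (g := fun s : ℝ => 2 * Real.log ((2 * θ + l) - l * Real.exp (-(2 * θ * β * s))))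
      (g' := fun s => 2 * β * u l s) (l := 2 * Real.log (2 * θ + l))
      (fun s hs => by
        have hs' : (0:ℝ) ≤ s := hs
        have h1 : HasDerivAt (fun s : ℝ => -(2 * θ * β * s)) (-(2 * θ * β)) s := by
          simpa using ((hasDerivAt_id s).const_mul (2 * θ * β)).fun_neg
        have h2 := (((h1.exp.const_mul l).const_sub (2 * θ + l)).log (hD s hs').ne').const_mul 2
        refine h2.congr_deriv ?_
        rw [hform s hs']
        ring)
      (fun s hs => by
        have hs' : (0:ℝ) ≤ s := le_of_lt hs
        simp only [hform s hs']
        have := hD s hs'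
        positivity) hlim
    rw [hint]
    have h0 : (2 * θ + l) - l * Real.exp (-(2 * θ * β * 0)) = 2 * θ := by simp
    rw [h0]
    have h2 : -(2 * Real.log (2 * θ + l) - 2 * Real.log (2 * θ)) =
        Real.log ((2 * θ / (2 * θ + l)) ^ 2) := by
      rw [Real.log_pow, Real.log_div (by positivity) hp.ne']
      push_cast
      ring
    rw [h2, Real.exp_log (by positivity)]
  · have h := Real.integral_rpow_mul_exp_neg_mul_Ioi (a := 2) (r := 2 * θ + l) (by norm_num) hp
    have hfun : ∀ z : ℝ, Real.exp (-l * z) * ((2 * θ) ^ 2 * z * Real.exp (-2 * θ * z)) =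
        (2 * θ) ^ 2 * (z ^ ((2:ℝ) - 1) * Real.exp (-((2 * θ + l) * z))) := fun z => by
      have h1 : (2:ℝ) - 1 = 1 := by norm_num
      have h2 : -((2 * θ + l) * z) = -l * z + -2 * θ * z := by ring
      rw [h1, Real.rpow_one, h2, Real.exp_add]
      ring
    simp_rw [hfun]
    rw [integral_const_mul, h, Real.Gamma_two, Real.rpow_two]
    field_simp
end
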